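/- arXiv:2105.11014 — 2 statements merged into one kernel-verified Lean document; each statement's English description precedes it below -/
import Mathlib

section
/- Let p be a prime and G ⊆ SL(3, F_p) a finite subgroup such that V = (F_p)³ contains two distinct 2-dimensional G-submodules. Then the invariant ring S(V)^G is Gorenstein. -/
noncomputable section
open CategoryTheory Matrix MvPolynomial

universe u

/-- A module `M` over `R` has finite injective dimension iff the Ext functors
`Ext^i(-, M)` vanish for all sufficiently large `i`. -/
def HasFiniteInjectiveDimension (R : Type u) [CommRing R] (M : ModuleCat.{u} R) : Prop :=
  ∃ n : ℕ, ∀ (N : ModuleCat.{u} R) (i : ℕ), n < i →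
    Subsingleton (((Ext R (ModuleCat.{u} R) i).obj (Opposite.op N)).obj M)

/-- A commutative ring is Gorenstein if it is Noetherian and its localization at every
prime ideal has finite injective dimension over itself. -/
def IsGorensteinRing (R : Type u) [CommRing R] : Prop :=
  IsNoetherianRing R ∧ ∀ (P : Ideal R) [P.IsPrime],
    HasFiniteInjectiveDimension (Localization.AtPrime P)
      (ModuleCat.of (Localization.AtPrime P) (Localization.AtPrime P))

/-- The substitution action of a matrix on polynomials: `X i ↦ ∑ j, M i j • X j`. -/
def polyAct {F : Type u} [CommSemiring F] {m : ℕ} (M : Matrix (Fin m) (Fin m) F) :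
    MvPolynomial (Fin m) F →ₐ[F] MvPolynomial (Fin m) F :=
  MvPolynomial.aeval fun i => ∑ j, M i j • MvPolynomial.X j

/-- The subalgebra of polynomials invariant under a set of matrices. -/
def invariantAlg {F : Type u} [CommSemiring F] {m : ℕ} (S : Set (Matrix (Fin m) (Fin m) F)) :
    Subalgebra F (MvPolynomial (Fin m) F) where
  carrier := {f | ∀ M ∈ S, polyAct M f = f}
  mul_mem' := fun hf hg => fun M hM => by rw [_root_.map_mul, hf M hM, hg M hM]
  add_mem' := fun hf hg => fun M hM => by rw [_root_.map_add, hf M hM, hg M hM]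
  algebraMap_mem' := fun r => fun M hM => (polyAct M).commutes r

/-- The invariant ring `S(V)^G` for a subgroup `G` of `SL(m, F)`, where `S(V)` is realised
as the polynomial ring `F[X 0, …, X (m-1)]`. -/
def invariantRing {F : Type u} [Field F] {m : ℕ}
    (G : Subgroup (Matrix.SpecialLinearGroup (Fin m) F)) :
    Subalgebra F (MvPolynomial (Fin m) F) :=
  invariantAlg {M | ∃ g ∈ G, (g : Matrix (Fin m) (Fin m) F) = M}

/-- A matrix `M` is a transvection if `rank (M - 1) = 1` and `(M - 1)² = 0`. -/
def IsTransvectionMat {F : Type u} [Field F] {m : ℕ} (M : Matrix (Fin m) (Fin m) F) : Prop :=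
  (M - 1).rank = 1 ∧ (M - 1) * (M - 1) = 0

/-- `T(G)`: the subgroup generated by all transvections contained in `G`. -/
def transSubgroup {F : Type u} [Field F] {m : ℕ}
    (G : Subgroup (Matrix.SpecialLinearGroup (Fin m) F)) :
    Subgroup (Matrix.SpecialLinearGroup (Fin m) F) :=
  Subgroup.closure {g | g ∈ G ∧ IsTransvectionMat (g : Matrix (Fin m) (Fin m) F)}

section Homological

open CategoryTheory.Abelian

/-- Vanishing of the derived-category `Ext` groups gives the vanishing of the classical ones. -/
theorem hasFiniteInjectiveDimension_of_hasInjectiveDimensionLT {R : Type u} [CommRing R]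
    (M : ModuleCat.{u} R) (n : ℕ) [HasInjectiveDimensionLT M n] :
    HasFiniteInjectiveDimension R M := by
  refine ⟨n, fun N i hi => ?_⟩
  obtain ⟨p, rfl⟩ : ∃ p, i = p + 1 := ⟨i - 1, by omega⟩
  let P := ProjectiveResolution.of N
  suffices h : Limits.IsZero ((P.complex.linearYonedaObj R M).homology (p + 1)) from
    ModuleCat.subsingleton_of_isZero (h.of_iso (P.isoExt (p + 1) M))
  rw [← HomologicalComplex.exactAt_iff_isZero_homology,
    HomologicalComplex.exactAt_iff' _ p (p + 1) (p + 2) (by simp) (by simp),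
    ShortComplex.moduleCat_exact_iff]
  intro f hf
  have hf' : P.complex.d (p + 2) (p + 1) ≫ (show P.complex.X (p + 1) ⟶ M from f) = 0 := hf
  obtain ⟨g, hg⟩ := (P.extMk_eq_zero_iff (show P.complex.X (p + 1) ⟶ M from f) (p + 2) rfl hf'
    p rfl).1 (Ext.eq_zero_of_hasInjectiveDimensionLT _ n (by omega))
  exact ⟨g, hg⟩

theorem isGorensteinRing_of_hasInjectiveDimensionLE {R : Type u} [CommRing R]
    [IsNoetherianRing R] (n : ℕ) (h : HasInjectiveDimensionLE (ModuleCat.of R R) n) :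
    IsGorensteinRing R := by
  refine ⟨inferInstance, fun P hP => ?_⟩
  have h1 : HasInjectiveDimensionLE ((ModuleCat.of R R).localizedModule P.primeCompl) n :=
    ModuleCat.localizedModule_hasInjectiveDimensionLE n _ _
  have h2 : HasInjectiveDimensionLE
      (ModuleCat.of (Localization.AtPrime P) (Localization.AtPrime P)) n := by
    have := ModuleCat.localizedModule_isLocalizedModule (ModuleCat.of R R) P.primeCompl
    let e := IsLocalizedModule.linearEquiv P.primeCompl
      ((ModuleCat.of R R).localizedModuleMkLinearMap P.primeCompl)
      (Algebra.linearMap R (Localization.AtPrime P))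
    let e' : ((ModuleCat.of R R).localizedModule P.primeCompl) ≃ₗ[Localization.AtPrime P]
        Localization.AtPrime P :=
      LinearEquiv.extendScalarsOfIsLocalization P.primeCompl (Localization.AtPrime P) e
    exact hasInjectiveDimensionLT_of_iso (e'.toModuleIso) (n + 1)
  exact hasFiniteInjectiveDimension_of_hasInjectiveDimensionLT _ (n + 1)

/-- Coinduction along a ring homomorphism with projective target does not raise the
injective dimension. -/
theorem hasInjectiveDimensionLE_coextendScalars {A R : Type u} [CommRing A] [CommRing R]
    (f : A →+* R) (hf : Projective ((ModuleCat.restrictScalars f).obj (ModuleCat.of R R)))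
    (M : ModuleCat.{u} A) (n : ℕ) (hM : HasInjectiveDimensionLE M n) :
    HasInjectiveDimensionLE ((ModuleCat.coextendScalars f).obj M) n := by
  have hadj := ModuleCat.restrictCoextendScalarsAdj.{u, u, u} f
  induction n generalizing M with
  | zero =>
    have : Injective M := by
      rwa [injective_iff_hasInjectiveDimensionLT_one]
    have := Injective.injective_of_adjoint hadj M
    exact injective_iff_hasInjectiveDimensionLT_one.1 this
  | succ n ih =>
    obtain ⟨I, _, g, _⟩ := EnoughInjectives.presentation M
    let S : ShortComplex (ModuleCat.{u} A) := ShortComplex.mk g (Limits.cokernel.π g) (by simp)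
    have hS : S.ShortExact := { exact := ShortComplex.exact_cokernel g }
    have hI := Injective.injective_of_adjoint hadj I
    have : (ModuleCat.coextendScalars f).PreservesZeroMorphisms := ⟨fun _ _ => rfl⟩
    have hF : (S.map (ModuleCat.coextendScalars f)).ShortExact := by
      have : Limits.PreservesLimits (ModuleCat.coextendScalars f) :=
        hadj.rightAdjoint_preservesLimits
      have hmono : Mono ((ModuleCat.coextendScalars f).map g) := inferInstance
      refine { exact := ?_, mono_f := hmono, epi_g := ?_ }
      · exact hS.exact.map_of_mono_of_preservesKernel _ inferInstance inferInstance
      · rw [ModuleCat.epi_iff_surjective]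
        intro h
        have hpi : Epi (Limits.cokernel.π g) := inferInstance
        let k := Projective.factorThru
          (ModuleCat.ofHom (ModuleCat.CoextendScalars.equiv f _ h)) (Limits.cokernel.π g)
        have hk : k ≫ Limits.cokernel.π g = ModuleCat.ofHom _ := Projective.factorThru_comp _ _
        exact ⟨(ModuleCat.CoextendScalars.equiv f _).symm k.hom,
          ModuleCat.CoextendScalars.ext (LinearMap.ext fun s =>
            ConcreteCategory.congr_hom hk s)⟩
    exact (hF.hasInjectiveDimensionLT_X₃_iff n hI).1
      (ih _ ((hS.hasInjectiveDimensionLT_X₃_iff n inferInstance).2 hM))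

end Homological

section Syzygy

/-- If `K` is the coinduction of the `A`-module `M` to an `A`-projective `A`-algebra `R`, then
the injective dimension of `K` over `R` is at most that of `M` over `A`. -/
theorem hasInjectiveDimensionLE_of_coinduced {A R K M : Type u} [CommRing A] [CommRing R]
    [Algebra A R] [Module.Projective A R] [AddCommGroup K] [Module R K] [Module A K]
    [IsScalarTower A R K] [AddCommGroup M] [Module A M] (ε : K →ₗ[A] M)
    (hinj : ∀ k, (∀ r : R, ε (r • k) = 0) → k = 0)
    (hsurj : ∀ g : R →ₗ[A] M, ∃ k, ∀ r : R, ε (r • k) = g r)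
    (n : ℕ) (hM : HasInjectiveDimensionLE (ModuleCat.of A M) n) :
    HasInjectiveDimensionLE (ModuleCat.of R K) n := by
  let f := algebraMap A R
  let e : R ≃ₗ[A] (ModuleCat.restrictScalars f).obj (ModuleCat.of R R) :=
    { AddEquiv.refl R with map_smul' := fun a x => Algebra.smul_def a x }
  have hproj : Projective ((ModuleCat.restrictScalars f).obj (ModuleCat.of R R)) := by
    rw [← IsProjective.iff_projective]
    exact Module.Projective.of_equiv e
  have h := hasInjectiveDimensionLE_coextendScalars f hproj (ModuleCat.of A M) n hM
  let E := ModuleCat.CoextendScalars.equiv f (ModuleCat.of A M)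
  let φ : K →ₗ[R] (ModuleCat.coextendScalars f).obj (ModuleCat.of A M) :=
    { toFun := fun k => E.symm
        ((ε ∘ₗ ((LinearMap.toSpanSingleton R K k).restrictScalars A)) ∘ₗ e.symm.toLinearMap)
      map_add' := fun x y => ModuleCat.CoextendScalars.ext (LinearMap.ext fun q =>
        show ε ((show R from q) • (x + y)) = ε ((show R from q) • x) + ε ((show R from q) • y) by
          rw [smul_add, map_add])
      map_smul' := fun r x => ModuleCat.CoextendScalars.ext (LinearMap.ext fun q =>
        show ε ((show R from q) • (r • x)) = ε (((show R from q) * r) • x) by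
          rw [mul_smul]) }
  have hφ : Function.Bijective φ := by
    constructor
    · rw [injective_iff_map_eq_zero]
      exact fun k hk => hinj k fun r => LinearMap.congr_fun (congrArg E hk) r
    · intro g
      obtain ⟨k, hk⟩ := hsurj (E g ∘ₗ e.toLinearMap)
      exact ⟨k, ModuleCat.CoextendScalars.ext (LinearMap.ext fun q => hk q)⟩
  exact hasInjectiveDimensionLT_of_iso (LinearEquiv.ofBijective φ hφ).symm.toModuleIso (n + 1)

/-- An additive map commuting with constants and with the variable is polynomial-linear. -/
def Polynomial.linearMapOfCommute {A M N : Type*} [CommRing A] [AddCommGroup M] [AddCommGroup N]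
    [Module (Polynomial A) M] [Module (Polynomial A) N] (φ : M →+ N)
    (hC : ∀ (a : A) m, φ (Polynomial.C a • m) = Polynomial.C a • φ m)
    (hX : ∀ m, φ ((Polynomial.X : Polynomial A) • m) = (Polynomial.X : Polynomial A) • φ m) :
    M →ₗ[Polynomial A] N :=
  { φ with
    map_smul' := fun (q : Polynomial A) (m : M) => by
      change φ (q • m) = q • φ m
      induction q using Polynomial.induction_on' with
      | add p q hp hq => rw [add_smul, map_add, hp, hq, add_smul]
      | monomial i a =>
        rw [← Polynomial.C_mul_X_pow_eq_monomial, mul_smul, hC, mul_smul]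
        congr 1
        induction i generalizing m with
        | zero => simp
        | succ i ih => rw [pow_succ, mul_smul, ih, hX, mul_smul] }

/-- A bound on the injective dimension of all modules passes to a polynomial ring, with one
added to it. -/
theorem hasInjectiveDimensionLE_polynomial {A : Type u} [CommRing A] (n : ℕ)
    (h : ∀ M : ModuleCat.{u} A, HasInjectiveDimensionLE M n) (M : ModuleCat.{u} (Polynomial A)) :
    HasInjectiveDimensionLE M (n + 1) := by
  let : Module A M := Module.compHom M (Polynomial.C : A →+* Polynomial A)
  have : IsScalarTower A (Polynomial A) M :=
    ⟨fun a q m => by rw [← Polynomial.C_mul', mul_smul]; rfl⟩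
  let shift : (ℕ → M) →ₗ[A] (ℕ → M) := LinearMap.funLeft A M Nat.succ
  let K := Module.AEval' shift
  let seq : (ℕ → M) ≃ₗ[A] K := Module.AEval.of A (ℕ → M) shift
  have hXseq : ∀ v, (Polynomial.X : Polynomial A) • seq v = seq (shift v) := fun v =>
    Module.AEval.X_smul_of ..
  have hpow : ∀ (i : ℕ) v j, seq.symm ((Polynomial.X ^ i : Polynomial A) • seq v) j =
      v (j + i) := by
    intro i
    induction i with
    | zero => simp
    | succ i ih =>
      intro v j
      rw [pow_succ, mul_smul, hXseq, ih]
      rfl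
  have hC : ∀ a (k : K), (Polynomial.C a : Polynomial A) • k = a • k := fun a k =>
    algebraMap_smul (Polynomial A) a k
  have hK : HasInjectiveDimensionLE (ModuleCat.of (Polynomial A) K) n := by
    refine hasInjectiveDimensionLE_of_coinduced (M := M)
      (LinearMap.proj 0 ∘ₗ seq.symm.toLinearMap) (fun k hk => ?_) (fun g => ?_) n (h _)
    · obtain ⟨v, rfl⟩ := seq.surjective k
      rw [map_eq_zero_iff _ seq.injective]
      funext i
      have := hk (Polynomial.X ^ i)
      simpa [hpow] using this
    · refine ⟨seq fun i => g (Polynomial.X ^ i), fun r => ?_⟩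
      induction r using Polynomial.induction_on' with
      | add p q hp hq => rw [add_smul, map_add, hp, hq, map_add]
      | monomial i a =>
        rw [← Polynomial.C_mul_X_pow_eq_monomial, mul_smul, hC, LinearMap.map_smul,
          Polynomial.C_mul', g.map_smul]
        congr 1
        exact (hpow i _ 0).trans (by rw [zero_add])
  let ι : M →ₗ[Polynomial A] K := Polynomial.linearMapOfCommute
    { toFun := fun m => seq fun i => (Polynomial.X ^ i : Polynomial A) • m
      map_zero' := by simp; rfl
      map_add' := fun x y => by rw [← map_add]; congr 1; funext i; exact smul_add _ _ _ }
    (fun a m => by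
      rw [hC]
      refine Eq.trans ?_ (seq.map_smul a _)
      refine congrArg seq (funext fun i => ?_)
      exact smul_comm (Polynomial.X ^ i : Polynomial A) (Polynomial.C a : Polynomial A) m)
    (fun m => by
      change seq _ = _ • seq _
      rw [hXseq]
      congr 1; funext i
      rw [smul_smul, ← pow_succ]; rfl)
  have hι : ∀ m, ι m = seq fun i => (Polynomial.X ^ i : Polynomial A) • m := fun m => rfl
  let δ₀ : (ℕ → M) →ₗ[A] (ℕ → M) := shift - LinearMap.pi fun i =>
    (Algebra.lsmul A A M (Polynomial.X : Polynomial A)) ∘ₗ LinearMap.proj i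
  have hδ₀ : ∀ v i, δ₀ v i = v (i + 1) - (Polynomial.X : Polynomial A) • v i := fun v i => rfl
  let δ : K →ₗ[Polynomial A] K := Polynomial.linearMapOfCommute
    (seq.toLinearMap ∘ₗ δ₀ ∘ₗ seq.symm.toLinearMap).toAddMonoidHom
    (fun a m => by
      rw [hC, hC]
      exact (seq.toLinearMap ∘ₗ δ₀ ∘ₗ seq.symm.toLinearMap).map_smul a m)
    (fun k => by
      obtain ⟨v, rfl⟩ := seq.surjective k
      rw [hXseq]
      change seq (δ₀ (seq.symm (seq _))) = _ • seq (δ₀ (seq.symm (seq _)))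
      rw [seq.symm_apply_apply, seq.symm_apply_apply, hXseq]
      rfl)
  have hδ : ∀ v, δ (seq v) = seq (δ₀ v) := fun v => by
    change seq (δ₀ (seq.symm (seq _))) = _
    rw [seq.symm_apply_apply]
  have hinj : Function.Injective ι := fun m m' hm => by
    have h0 := congrFun (seq.injective (a₁ := fun i => (Polynomial.X ^ i : Polynomial A) • m)
      (a₂ := fun i => (Polynomial.X ^ i : Polynomial A) • m') hm) 0
    simpa only [pow_zero, one_smul] using h0
  have hexact : Function.Exact ι δ := by
    intro k
    constructor
    · intro hk
      obtain ⟨v, rfl⟩ := seq.surjective k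
      rw [hδ, map_eq_zero_iff _ seq.injective] at hk
      refine ⟨v 0, ?_⟩
      rw [hι]
      congr 1
      funext i
      induction i with
      | zero => simp
      | succ i ih =>
        rw [pow_succ', mul_smul, ih]
        exact (sub_eq_zero.1 (congrFun hk i)).symm
    · rintro ⟨m, rfl⟩
      rw [hι, hδ, map_eq_zero_iff _ seq.injective]
      funext i
      rw [hδ₀, pow_succ', mul_smul]
      exact sub_self _
  have hsurj : Function.Surjective δ := by
    intro k
    obtain ⟨w, rfl⟩ := seq.surjective k
    let v : ℕ → M := fun i => Nat.rec 0 (fun i x => w i + (Polynomial.X : Polynomial A) • x) i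
    refine ⟨seq v, ?_⟩
    rw [hδ]
    congr 1
    funext i
    exact add_sub_cancel_right _ _
  let S := ModuleCat.shortComplexOfCompEqZero ι δ hexact.linearMap_comp_eq_zero
  have hS : S.ShortExact := ModuleCat.shortComplex_shortExact S hexact hinj hsurj
  have hX₂ : HasInjectiveDimensionLT S.X₂ (n + 1) := hK
  have hX₃ : HasInjectiveDimensionLT S.X₃ (n + 1) := hK
  exact hS.hasInjectiveDimensionLT_X₁ (n + 1) hX₃
    (hasInjectiveDimensionLT_of_ge _ (n + 1) _ (by omega))

end Syzygy

section Frobenius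

/-- A bound on the injective dimension of all modules transfers along a ring isomorphism. -/
theorem hasInjectiveDimensionLE_of_ringEquiv {A B : Type u} [CommRing A] [CommRing B]
    (e : A ≃+* B) (n : ℕ) (h : ∀ M : ModuleCat.{u} A, HasInjectiveDimensionLE M n)
    (M : ModuleCat.{u} B) : HasInjectiveDimensionLE M n := by
  have := RingHomInvPair.of_ringEquiv e
  have := RingHomInvPair.of_ringEquiv e.symm
  let M' : ModuleCat.{u} A :=
    let := Module.compHom M e.toRingHom
    ModuleCat.of A M
  let eM : M' ≃ₛₗ[RingHomClass.toRingHom e] M :=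
    { __ := AddEquiv.refl M
      map_smul' := fun r i => rfl }
  exact (ModuleCat.hasInjectiveDimensionLE_iff_of_semiLinearEquiv e eM n).1 (h M')

/-- A polynomial ring in `k` variables over a field has global dimension at most `k`. -/
theorem hasInjectiveDimensionLE_mvPolynomial (F : Type u) [Field F] (k : ℕ)
    (M : ModuleCat.{u} (MvPolynomial (Fin k) F)) : HasInjectiveDimensionLE M k := by
  induction k with
  | zero =>
    refine hasInjectiveDimensionLE_of_ringEquiv
      (MvPolynomial.isEmptyAlgEquiv F (Fin 0)).symm.toRingEquiv 0 (fun N => ?_) M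
    have := Module.injective_of_isSemisimpleRing F N
    exact injective_iff_hasInjectiveDimensionLT_one.1
      (Module.injective_object_of_injective_module F N)
  | succ k ih =>
    exact hasInjectiveDimensionLE_of_ringEquiv (MvPolynomial.finSuccEquiv F k).symm.toRingEquiv
      (k + 1) (hasInjectiveDimensionLE_polynomial k ih) M

/-- A Frobenius extension of a Noetherian ring of finite self-injective dimension is Gorenstein. -/
theorem isGorensteinRing_of_frobenius {B R : Type u} {ι : Type*} [CommRing B] [IsNoetherianRing B]
    [CommRing R] [Fintype ι] (n : ℕ) (hB : HasInjectiveDimensionLE (ModuleCat.of B B) n)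
    (f : B →+* R) (l : R →+ B) (hl : ∀ β r, l (f β * r) = β * l r) (b b' : ι → R)
    (h : ∀ r, ∑ i, f (l (r * b' i)) * b i = r) : IsGorensteinRing R := by
  let := f.toAlgebra
  have hsmul : ∀ (β : B) (r : R), β • r = f β * r := fun β r => Algebra.smul_def β r
  let L : R →ₗ[B] B :=
    { l with map_smul' := fun β r => by
              change l (β • r) = β * l r
              rw [hsmul, hl] }
  have hL : ∀ r, L r = l r := fun r => rfl
  have hfin : Module.Finite B R := by
    refine Module.Finite.of_surjective (Fintype.linearCombination B b) fun r => ?_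
    refine ⟨fun i => l (r * b' i), ?_⟩
    simp only [Fintype.linearCombination_apply, hsmul, h]
  have hnoeth : IsNoetherianRing R := IsNoetherianRing.of_finite B R
  have hproj : Module.Projective B R := by
    refine Module.Projective.of_split
      (LinearMap.pi fun i => L ∘ₗ LinearMap.mulRight B (b' i))
      (Fintype.linearCombination B b) (LinearMap.ext fun r => ?_)
    simp only [LinearMap.comp_apply, Fintype.linearCombination_apply, hsmul, LinearMap.pi_apply,
      LinearMap.mulRight_apply, hL, h, LinearMap.id_apply]
  refine isGorensteinRing_of_hasInjectiveDimensionLE n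
    (hasInjectiveDimensionLE_of_coinduced L (fun s hs => ?_) (fun g => ?_) n hB)
  · rw [← h s]
    refine Finset.sum_eq_zero fun i _ => ?_
    have := hs (b' i)
    rw [smul_eq_mul, hL, mul_comm] at this
    rw [this, map_zero, zero_mul]
  · refine ⟨∑ i, g (b i) • b' i, fun r => ?_⟩
    conv_rhs => rw [← h r]
    simp only [map_sum, Finset.smul_sum, ← hsmul, LinearMap.map_smul]
    refine Finset.sum_congr rfl fun i _ => ?_
    rw [smul_comm, LinearMap.map_smul, smul_eq_mul, smul_eq_mul, mul_comm]
    rfl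

/-- A ring isomorphic to a Frobenius extension of a Noetherian ring of finite self-injective
dimension is Gorenstein. -/
theorem isGorensteinRing_of_frobenius_of_ringEquiv {B R R' : Type u} {ι : Type*} [CommRing B]
    [IsNoetherianRing B] [CommRing R] [CommRing R'] [Fintype ι] (n : ℕ)
    (hB : HasInjectiveDimensionLE (ModuleCat.of B B) n)
    (f : B →+* R) (l : R →+ B) (hl : ∀ β r, l (f β * r) = β * l r) (b b' : ι → R)
    (h : ∀ r, ∑ i, f (l (r * b' i)) * b i = r) (e : R ≃+* R') : IsGorensteinRing R' := by
  refine isGorensteinRing_of_frobenius n hB (e.toRingHom.comp f)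
    (l.comp e.symm.toAddEquiv.toAddMonoidHom) (fun β r => ?_) (e ∘ b) (e ∘ b') fun r => ?_
  · change l (e.symm (e (f β) * r)) = β * l (e.symm r)
    rw [map_mul, e.symm_apply_apply, hl]
  · change ∑ i, e (f (l (e.symm (r * e (b' i))))) * e (b i) = r
    simp only [map_mul, e.symm_apply_apply]
    simp only [← map_mul, ← map_sum, h, e.apply_symm_apply]

end Frobenius

section Diagonal

variable {F : Type u} [Field F] {k : ℕ}

/-- The exponent vector with the given coordinates. -/
def exponent (v : Fin k → ℕ) : Fin k →₀ ℕ := Finsupp.equivFunOnFinite.symm v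

@[simp]
theorem exponent_apply (v : Fin k → ℕ) (i : Fin k) : exponent v i = v i := rfl

/-- The retraction of `F[X]` onto `F[X ^ m]` picking out the exponents congruent to `-1`. -/
def expandTrace (F : Type u) [Field F] (k m : ℕ) :
    MvPolynomial (Fin k) F →ₗ[F] MvPolynomial (Fin k) F :=
  (MvPolynomial.basisMonomials (Fin k) F).constr F fun u =>
    if ∀ i, m ∣ u i + 1 then monomial (exponent fun i => u i / m) 1 else 0

theorem expandTrace_monomial (m : ℕ) (u : Fin k →₀ ℕ) (c : F) :
    expandTrace F k m (monomial u c) =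
      if ∀ i, m ∣ u i + 1 then monomial (exponent fun i => u i / m) c else 0 := by
  have h : monomial u c = c • MvPolynomial.basisMonomials (Fin k) F u := by
    rw [MvPolynomial.coe_basisMonomials, MvPolynomial.smul_monomial, smul_eq_mul, mul_one]
  rw [h, map_smul, expandTrace, Module.Basis.constr_basis]
  split_ifs
  · rw [MvPolynomial.smul_monomial, smul_eq_mul, mul_one]
  · exact smul_zero c

theorem add_sub_one_sub_mod_add_one {m : ℕ} (hm : 0 < m) (a : ℕ) :
    a + (m - 1 - a % m) + 1 = m * (a / m + 1) := by
  have h1 := Nat.div_add_mod a m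
  have h2 := Nat.mod_lt a hm
  rw [mul_add, mul_one]
  omega

theorem add_sub_one_sub_mod_div {m : ℕ} (hm : 0 < m) (a : ℕ) :
    (a + (m - 1 - a % m)) / m = a / m := by
  have h1 := Nat.div_add_mod a m
  have h2 := Nat.mod_lt a hm
  have h3 : a + (m - 1 - a % m) = m * (a / m) + (m - 1) := by omega
  rw [h3, Nat.mul_add_div hm, Nat.div_eq_of_lt (by omega : m - 1 < m), add_zero]

theorem mod_eq_of_dvd_add_sub {m a v : ℕ} (hv : v < m) (h : m ∣ a + (m - 1 - v) + 1) :
    a % m = v := by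
  obtain ⟨t, ht⟩ := h
  obtain rfl | ⟨s, rfl⟩ : t = 0 ∨ ∃ s, t = s + 1 := by
    cases t
    · exact Or.inl rfl
    · exact Or.inr ⟨_, rfl⟩
  · omega
  · rw [mul_add, mul_one] at ht
    have : a = m * s + v := by omega
    rw [this, Nat.mul_add_mod, Nat.mod_eq_of_lt hv]

theorem expandTrace_expand_mul {m : ℕ} (hm : 0 < m) (q r : MvPolynomial (Fin k) F) :
    expandTrace F k m (expand m q * r) = q * expandTrace F k m r := by
  induction q using MvPolynomial.induction_on' with
  | add p q hp hq => rw [map_add, add_mul, map_add, hp, hq, add_mul]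
  | monomial s c =>
    induction r using MvPolynomial.induction_on' with
    | add p q hp hq => rw [mul_add, map_add, hp, hq, map_add, mul_add]
    | monomial u d =>
      rw [expand_monomial, monomial_mul, expandTrace_monomial, expandTrace_monomial]
      have h1 : ∀ i, m ∣ (m • s + u) i + 1 ↔ m ∣ u i + 1 := fun i => by
        rw [Finsupp.add_apply, Finsupp.smul_apply, smul_eq_mul, add_assoc]
        exact Nat.dvd_add_right (dvd_mul_right m _)
      simp only [h1]
      split_ifs
      · rw [monomial_mul]
        congr 2
        ext i
        simp [Nat.mul_add_div hm]
      · rw [mul_zero]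

theorem sum_expand_expandTrace {m : ℕ} (hm : 0 < m) (r : MvPolynomial (Fin k) F) :
    ∑ v : Fin k → Fin m,
      expand m (expandTrace F k m (r * monomial (exponent fun i => m - 1 - v i) 1)) *
        monomial (exponent fun i => (v i : ℕ)) 1 = r := by
  induction r using MvPolynomial.induction_on' with
  | add p q hp hq =>
    conv_rhs => rw [← hp, ← hq]
    simp only [add_mul, map_add, Finset.sum_add_distrib]
  | monomial u c =>
    rw [Finset.sum_eq_single fun i => (⟨u i % m, Nat.mod_lt _ hm⟩ : Fin m)]
    · have hdvd : ∀ i, m ∣ (u + exponent fun i => m - 1 - u i % m) i + 1 := fun i => by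
        rw [Finsupp.add_apply, exponent_apply, add_sub_one_sub_mod_add_one hm]
        exact dvd_mul_right m _
      rw [monomial_mul, expandTrace_monomial, if_pos hdvd, expand_monomial, monomial_mul,
        mul_one, mul_one]
      congr 2
      ext i
      simp only [Finsupp.add_apply, Finsupp.smul_apply, smul_eq_mul, exponent_apply]
      rw [add_sub_one_sub_mod_div hm, Nat.div_add_mod]
    · intro v _ hv
      rw [monomial_mul, expandTrace_monomial, if_neg, map_zero, zero_mul]
      refine fun h => hv (funext fun i => Fin.ext ?_)
      exact (mod_eq_of_dvd_add_sub (v i).2 (h i)).symm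
    · exact fun h => absurd (Finset.mem_univ _) h

theorem polyAct_diagonal_monomial (χ : Fin k → F) (u : Fin k →₀ ℕ) (c : F) :
    polyAct (Matrix.diagonal χ) (monomial u c) = monomial u (c * ∏ i, χ i ^ u i) := by
  have h (i) : ∑ j, Matrix.diagonal χ i j • (X j : MvPolynomial (Fin k) F) = χ i • X i := by
    rw [Finset.sum_eq_single i]
    · rw [Matrix.diagonal_apply_eq]
    · intro j _ hj
      rw [Matrix.diagonal_apply_ne' _ hj, zero_smul]
    · exact fun h => absurd (Finset.mem_univ _) h
  rw [polyAct, aeval_monomial, Finsupp.prod_fintype _ _ (by simp)]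
  simp only [h, smul_pow, Finset.prod_smul, algebraMap_eq]
  rw [monomial_eq, Finsupp.prod_fintype _ _ (by simp), mul_smul_comm, ← C_mul', ← mul_assoc,
    ← C_mul, mul_comm c]

theorem coeff_polyAct_diagonal (χ : Fin k → F) (u : Fin k →₀ ℕ) (f : MvPolynomial (Fin k) F) :
    coeff u (polyAct (Matrix.diagonal χ) f) = coeff u f * ∏ i, χ i ^ u i := by
  induction f using MvPolynomial.induction_on' with
  | add p q hp hq => rw [map_add, coeff_add, hp, hq, coeff_add, add_mul]
  | monomial s c =>
    rw [polyAct_diagonal_monomial, coeff_monomial, coeff_monomial]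
    split_ifs with h
    · rw [h]
    · rw [zero_mul]

theorem mem_invariantAlg_diagonal (S : Set (Fin k → F)) (f : MvPolynomial (Fin k) F) :
    f ∈ invariantAlg (Matrix.diagonal '' S) ↔
      ∀ u ∈ f.support, ∀ χ ∈ S, ∏ i, χ i ^ u i = 1 := by
  change (∀ M ∈ Matrix.diagonal '' S, polyAct M f = f) ↔ _
  simp only [Set.forall_mem_image, MvPolynomial.ext_iff, coeff_polyAct_diagonal,
    MvPolynomial.mem_support_iff]
  constructor
  · intro h u hu χ hχ
    exact (mul_right_eq_self₀.1 (h hχ u)).resolve_right hu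
  · intro h χ hχ u
    by_cases hu : coeff u f = 0
    · rw [hu, zero_mul]
    · rw [h u hu χ hχ, mul_one]

/-- A ring spanned by monomials of exponents satisfying a system of congruences modulo `m`, which
has `(-1, …, -1)` as a solution, is Gorenstein. -/
theorem isGorensteinRing_of_ringEquiv_monomial {m : ℕ} (hm : 0 < m) (S : Set (Fin k → F))
    (hS : ∀ χ ∈ S, ∀ i, χ i ^ m = 1) (hprod : ∀ χ ∈ S, ∏ i, χ i = 1)
    (A : Subalgebra F (MvPolynomial (Fin k) F))
    (hA : ∀ f, f ∈ A ↔ ∀ u ∈ f.support, ∀ χ ∈ S, ∏ i, χ i ^ u i = 1) {R : Type u} [CommRing R]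
    (e : A ≃+* R) : IsGorensteinRing R := by
  classical
  let good (v : Fin k → Fin m) : Prop := ∀ χ ∈ S, ∏ i, χ i ^ (v i : ℕ) = 1
  have hmon : ∀ (u : Fin k →₀ ℕ) (c : F), (∀ χ ∈ S, ∏ i, χ i ^ u i = 1) → monomial u c ∈ A := by
    intro u c h
    rw [hA]
    intro v hv
    rwa [Finset.mem_singleton.1 (support_monomial_subset hv)]
  have hexp : ∀ q : MvPolynomial (Fin k) F, expand m q ∈ A := fun q => by
    induction q using MvPolynomial.induction_on' with
    | add p q hp hq => exact (map_add (expand m) p q).symm ▸ A.add_mem hp hq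
    | monomial s c =>
      rw [expand_monomial]
      refine hmon _ c fun χ hχ => ?_
      simp [pow_mul, hS χ hχ]
  have hcompl : ∀ v, good v → ∀ χ ∈ S, ∏ i, χ i ^ (exponent fun i => m - 1 - v i) i = 1 := by
    intro v hv χ hχ
    have h1 : (∏ i, χ i ^ (m - 1 - v i)) * ∏ i, χ i ^ (v i : ℕ) = ∏ i, χ i ^ (m - 1) := by
      rw [← Finset.prod_mul_distrib]
      refine Finset.prod_congr rfl fun i _ => ?_
      rw [← pow_add, Nat.sub_add_cancel (by have := (v i).2; omega)]
    rwa [hv χ hχ, mul_one, Finset.prod_pow, hprod χ hχ, one_pow] at h1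
  have hb : ∀ v, ∃ b b' : A, (good v → (b : MvPolynomial (Fin k) F) =
      monomial (exponent fun i => (v i : ℕ)) 1 ∧
      (b' : MvPolynomial (Fin k) F) = monomial (exponent fun i => m - 1 - v i) 1) ∧
      (¬ good v → b = 0) := by
    intro v
    by_cases h : good v
    · exact ⟨⟨_, hmon _ 1 h⟩, ⟨_, hmon _ 1 (hcompl v h)⟩, fun _ => ⟨rfl, rfl⟩,
        fun h' => (h' h).elim⟩
    · exact ⟨0, 0, fun h' => (h h').elim, fun _ => rfl⟩
  choose b b' hgood hbad using hb
  let f : MvPolynomial (Fin k) F →+* A := ((expand m).codRestrict A hexp).toRingHom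
  have hf : ∀ q, (f q : MvPolynomial (Fin k) F) = expand m q := fun q => rfl
  let l : A →+ MvPolynomial (Fin k) F := (expandTrace F k m ∘ₗ A.val.toLinearMap).toAddMonoidHom
  have hl : ∀ r, l r = expandTrace F k m r := fun r => rfl
  clear_value f l
  refine isGorensteinRing_of_frobenius_of_ringEquiv k
    (hasInjectiveDimensionLE_mvPolynomial F k _) f l (fun q r => ?_) b b' (fun r => ?_) e
  · rw [hl, hl, MulMemClass.coe_mul, hf, expandTrace_expand_mul hm]
  rw [← Subtype.coe_inj, AddSubmonoidClass.coe_finsetSum]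
  conv_rhs => rw [← sum_expand_expandTrace hm (r : MvPolynomial (Fin k) F)]
  refine Finset.sum_congr rfl fun v _ => ?_
  rw [MulMemClass.coe_mul, hf, hl, MulMemClass.coe_mul]
  by_cases h : good v
  · rw [(hgood v h).1, (hgood v h).2]
  · rw [hbad v h, ZeroMemClass.coe_zero, mul_zero]
    suffices h0 : expandTrace F k m ((r : MvPolynomial (Fin k) F) *
        monomial (exponent fun i => m - 1 - v i) 1) = 0 by rw [h0, map_zero, zero_mul]
    rw [(r : MvPolynomial (Fin k) F).as_sum, Finset.sum_mul, map_sum]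
    refine Finset.sum_eq_zero fun u hu => ?_
    rw [monomial_mul, expandTrace_monomial, if_neg]
    refine fun hdvd => h fun χ hχ => ?_
    rw [← (hA _).1 r.2 u hu χ hχ]
    refine Finset.prod_congr rfl fun i _ => ?_
    rw [← mod_eq_of_dvd_add_sub (v i).2 (hdvd i), ← pow_eq_pow_mod _ (hS χ hχ i)]

/-- A ring of invariants of diagonal matrices of determinant one and exponent `m` is Gorenstein. -/
theorem isGorensteinRing_of_ringEquiv_diagonal {m : ℕ} (hm : 0 < m) (S : Set (Fin k → F))
    (hS : ∀ χ ∈ S, ∀ i, χ i ^ m = 1) (hprod : ∀ χ ∈ S, ∏ i, χ i = 1) {R : Type u} [CommRing R]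
    (e : invariantAlg (Matrix.diagonal '' S) ≃+* R) : IsGorensteinRing R :=
  isGorensteinRing_of_ringEquiv_monomial hm S hS hprod _ (mem_invariantAlg_diagonal S) e

end Diagonal

section ArtinSchreier

variable {p : ℕ} [Fact p.Prime]

/-- A polynomial over a domain of characteristic `p` that is invariant under the translation by a
nonzero `x` is a polynomial in `X ^ p - x ^ (p - 1) X`. -/
theorem Polynomial.exists_comp_eq_of_comp_X_add_C_eq {D : Type*} [CommRing D] [IsDomain D]
    [CharP D p] {x : D} (hx : x ≠ 0) (q : Polynomial D)
    (hq : q.comp (Polynomial.X + Polynomial.C x) = q) :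
    ∃ h : Polynomial D,
      h.comp (Polynomial.X ^ p - Polynomial.C (x ^ (p - 1)) * Polynomial.X) = q := by
  have hp : p.Prime := Fact.out
  set Y : Polynomial D := Polynomial.X ^ p - Polynomial.C (x ^ (p - 1)) * Polynomial.X with hY
  have hdeg : (Polynomial.C (x ^ (p - 1)) * Polynomial.X).degree < (p : WithBot ℕ) :=
    (Polynomial.degree_C_mul_X_le _).trans_lt (by exact_mod_cast hp.one_lt)
  have hmonic : Y.Monic := (Polynomial.monic_X_pow p).sub_of_left (by
    rwa [Polynomial.degree_X_pow])
  have hYdeg : Y.natDegree = p :=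
    Polynomial.natDegree_eq_of_degree_eq_some ((Polynomial.degree_sub_eq_left_of_degree_lt (by
      rwa [Polynomial.degree_X_pow])).trans (Polynomial.degree_X_pow p))
  have hroot : ∀ c : ℕ, Y.eval (c * x) = 0 := fun c => by
    have hc : (c : D) ^ p = c := by
      rw [← Nat.cast_pow, CharP.natCast_eq_natCast D p, ← ZMod.natCast_eq_natCast_iff,
        Nat.cast_pow, ZMod.pow_card]
    have hxp : x ^ p = x ^ (p - 1) * x := by rw [← pow_succ, Nat.sub_add_cancel hp.one_le]
    simp only [hY, Polynomial.eval_sub, Polynomial.eval_pow, Polynomial.eval_X,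
      Polynomial.eval_mul, Polynomial.eval_C, mul_pow, hc, hxp]
    ring
  have hYcomp : Y.comp (Polynomial.X + Polynomial.C x) = Y := by
    have hxp : x ^ p = x ^ (p - 1) * x := by rw [← pow_succ, Nat.sub_add_cancel hp.one_le]
    have : ExpChar (Polynomial D) p := ExpChar.prime hp
    simp only [hY, Polynomial.sub_comp, Polynomial.pow_comp, Polynomial.X_comp,
      Polynomial.mul_comp, Polynomial.C_comp, add_pow_expChar, ← Polynomial.C_pow, hxp,
      Polynomial.C_mul]
    ring
  induction hn : q.natDegree using Nat.strong_induction_on generalizing q with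
  | _ n ih =>
  have heval : ∀ c : ℕ, q.eval (c * x) = q.eval 0 := fun c => by
    induction c with
    | zero => simp
    | succ c ihc =>
      rw [← ihc]
      conv_rhs => rw [← hq]
      simp [add_mul]
  have hdvd : Y ∣ q - Polynomial.C (q.eval 0) := by
    rw [← Polynomial.modByMonic_eq_zero_iff_dvd hmonic]
    refine Polynomial.eq_zero_of_natDegree_lt_card_of_eval_eq_zero _
      (f := fun c : Fin p => ((c : ℕ) : D) * x) ?_ (fun c => ?_) ?_
    · intro c c' h
      have h := mul_right_cancel₀ hx h
      have h' := (CharP.natCast_eq_natCast D p).1 h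
      exact Fin.ext (Nat.ModEq.eq_of_lt_of_lt h' c.2 c'.2)
    · have h := congrArg (Polynomial.eval ((c : D) * x))
        (Polynomial.modByMonic_add_div (q - Polynomial.C (q.eval 0)) Y)
      simpa [hroot, heval] using h
    · rw [Fintype.card_fin]
      refine (Polynomial.natDegree_modByMonic_lt _ hmonic ?_).trans_eq hYdeg
      intro h1
      rw [h1, Polynomial.natDegree_one] at hYdeg
      exact hp.ne_zero hYdeg.symm
  obtain ⟨q₁, hq₁⟩ := hdvd
  have hq₂ : q = Polynomial.C (q.eval 0) + Y * q₁ := by rw [← hq₁]; ring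
  by_cases h0 : q₁ = 0
  · refine ⟨Polynomial.C (q.eval 0), ?_⟩
    rw [Polynomial.C_comp]
    rw [h0, mul_zero, add_zero] at hq₂
    exact hq₂.symm
  · have hinv : q₁.comp (Polynomial.X + Polynomial.C x) = q₁ := by
      refine mul_left_cancel₀ hmonic.ne_zero ?_
      rw [← hq₁]
      conv_lhs => rw [← hYcomp]
      rw [← Polynomial.mul_comp, ← hq₁, Polynomial.sub_comp, hq, Polynomial.C_comp]
    have hlt : q₁.natDegree < n := by
      have h2 : (q - Polynomial.C (q.eval 0)).natDegree = p + q₁.natDegree := by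
        rw [hq₁, Polynomial.natDegree_mul hmonic.ne_zero h0, hYdeg]
      rw [Polynomial.natDegree_sub_C, hn] at h2
      have := hp.pos
      omega
    obtain ⟨h, hh⟩ := ih _ hlt q₁ hinv rfl
    refine ⟨Polynomial.C (q.eval 0) + Polynomial.X * h, ?_⟩
    rw [Polynomial.add_comp, Polynomial.C_comp, Polynomial.mul_comp, Polynomial.X_comp, hh, ← hq₂]

variable {F : Type u} [Field F] {n : ℕ}

/-- The substitution `X i ↦ X i ^ p - X j ^ (p - 1) X i` fixing the other variables. -/
def artinSchreierHom (F : Type u) [Field F] (p : ℕ) {n : ℕ} (i j : Fin n) :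
    MvPolynomial (Fin n) F →ₐ[F] MvPolynomial (Fin n) F :=
  aeval fun k => if k = i then X i ^ p - X j ^ (p - 1) * X i else X k

theorem polyAct_X {m : ℕ} (M : Matrix (Fin m) (Fin m) F) (i : Fin m) :
    polyAct M (X i) = ∑ j, M i j • X j := by
  rw [polyAct, aeval_X]

theorem polyAct_transvection_X {i j : Fin n} (k : Fin n) :
    polyAct (Matrix.transvection i j (1 : F)) (X k) = X k + if k = i then X j else 0 := by
  rw [polyAct_X]
  simp only [Matrix.transvection, Matrix.add_apply, add_smul, Finset.sum_add_distrib]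
  congr 1
  · simp [Matrix.one_apply]
  · split_ifs with h
    · subst h
      simp [Matrix.single_apply]
    · simp [Ne.symm h]

/-- Singling out the variable `i`. -/
def variableEquiv (F : Type u) [Field F] {n : ℕ} (i : Fin (n + 1)) :
    MvPolynomial (Fin (n + 1)) F ≃ₐ[F] Polynomial (MvPolynomial (Fin n) F) :=
  (renameEquiv F (finSuccEquiv' i)).trans (optionEquivLeft F (Fin n))

theorem variableEquiv_X_self (i : Fin (n + 1)) : variableEquiv F i (X i) = Polynomial.X := by
  simp [variableEquiv, finSuccEquiv'_at]

theorem variableEquiv_X_succAbove (i : Fin (n + 1)) (j : Fin n) :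
    variableEquiv F i (X (i.succAbove j)) = Polynomial.C (X j) := by
  simp [variableEquiv, finSuccEquiv'_succAbove]

theorem variableEquiv_aeval (i : Fin (n + 1)) (t : MvPolynomial (Fin (n + 1)) F)
    (f : MvPolynomial (Fin (n + 1)) F) :
    variableEquiv F i (aeval (fun k => if k = i then t else X k) f) =
      (variableEquiv F i f).comp (variableEquiv F i t) := by
  suffices h : (variableEquiv F i).toAlgHom.comp (aeval fun k => if k = i then t else X k) =
      ((Polynomial.aeval (R := MvPolynomial (Fin n) F) (variableEquiv F i t)).restrictScalars F).comp
        (variableEquiv F i).toAlgHom from DFunLike.congr_fun h f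
  refine MvPolynomial.algHom_ext fun k => ?_
  obtain rfl | ⟨j, rfl⟩ := Fin.eq_self_or_eq_succAbove i k
  · simp [variableEquiv_X_self]
  · simp [variableEquiv_X_succAbove, Fin.succAbove_ne]

theorem polyAct_transvection_eq_aeval (i j : Fin n) :
    polyAct (Matrix.transvection i j (1 : F)) =
      aeval fun k => if k = i then X i + X j else X k := by
  refine MvPolynomial.algHom_ext fun k => ?_
  rw [polyAct_transvection_X, aeval_X]
  split_ifs with h
  · rw [h]
  · rw [add_zero]

theorem artinSchreierHom_injective {i j : Fin (n + 1)} (hij : j ≠ i) :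
    Function.Injective (artinSchreierHom F p i j) := by
  obtain ⟨j, rfl⟩ := Fin.exists_succAbove_eq hij
  have hp : p.Prime := Fact.out
  rw [injective_iff_map_eq_zero]
  intro f hf
  have hf := congrArg (variableEquiv F i) hf
  rw [artinSchreierHom, variableEquiv_aeval, map_zero, Polynomial.comp_eq_zero_iff] at hf
  obtain hf | ⟨-, hf⟩ := hf
  · exact (map_eq_zero_iff _ (variableEquiv F i).injective).1 hf
  · have h := congrArg (fun q => Polynomial.coeff q p) hf
    rw [Polynomial.coeff_C_of_ne_zero hp.ne_zero, map_sub, map_mul, map_pow, map_pow,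
      variableEquiv_X_self, variableEquiv_X_succAbove, ← Polynomial.C_pow, Polynomial.coeff_sub,
      Polynomial.coeff_X_pow_self, Polynomial.coeff_C_mul, Polynomial.coeff_X_of_ne_one hp.ne_one,
      mul_zero, sub_zero] at h
    exact absurd h one_ne_zero

theorem mem_range_artinSchreierHom [CharP F p] {i j : Fin (n + 1)} (hij : j ≠ i)
    (f : MvPolynomial (Fin (n + 1)) F) (hf : polyAct (Matrix.transvection i j 1) f = f) :
    ∃ h, artinSchreierHom F p i j h = f := by
  obtain ⟨j, rfl⟩ := Fin.exists_succAbove_eq hij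
  rw [polyAct_transvection_eq_aeval] at hf
  have hf := congrArg (variableEquiv F i) hf
  rw [variableEquiv_aeval, map_add, variableEquiv_X_self, variableEquiv_X_succAbove] at hf
  obtain ⟨h, hh⟩ := Polynomial.exists_comp_eq_of_comp_X_add_C_eq (p := p) (X_ne_zero j) _ hf
  refine ⟨(variableEquiv F i).symm h, (variableEquiv F i).injective ?_⟩
  rw [artinSchreierHom, variableEquiv_aeval, AlgEquiv.apply_symm_apply]
  simpa [variableEquiv_X_self, variableEquiv_X_succAbove] using hh

end ArtinSchreier

section Triangular

variable {p : ℕ} [Fact p.Prime]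

theorem polyAct_X_eq_of_row {i : Fin 3} (hi : i ≠ 0) (T : Matrix (Fin 3) (Fin 3) (ZMod p))
    (hT : ∀ j, j ≠ 0 → j ≠ i → T i j = 0) :
    polyAct T (X i) = T i 0 • X 0 + T i i • X i := by
  rw [polyAct_X, ← Finset.sum_subset (Finset.subset_univ {0, i}), Finset.sum_pair hi.symm]
  intro j _ hj
  simp only [Finset.mem_insert, Finset.mem_singleton, not_or] at hj
  rw [hT j hj.1 hj.2, zero_smul]

theorem polyAct_artinSchreierHom_X {i : Fin 3} (hi : i ≠ 0) (T : Matrix (Fin 3) (Fin 3) (ZMod p))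
    (h0 : polyAct T (X 0) = T 0 0 • X 0) (hT0 : T 0 0 ≠ 0)
    (hT : ∀ j, j ≠ 0 → j ≠ i → T i j = 0) :
    polyAct T (artinSchreierHom (ZMod p) p i 0 (X i)) =
      T i i • artinSchreierHom (ZMod p) p i 0 (X i) := by
  have hp : p.Prime := Fact.out
  have : ExpChar (MvPolynomial (Fin 3) (ZMod p)) p := ExpChar.prime hp
  have hx : (X 0 : MvPolynomial (Fin 3) (ZMod p)) ^ p = X 0 ^ (p - 1) * X 0 := by
    rw [← pow_succ, Nat.sub_add_cancel hp.one_le]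
  rw [artinSchreierHom, aeval_X, if_pos rfl, map_sub, map_mul, map_pow, map_pow, h0,
    polyAct_X_eq_of_row hi T hT, add_pow_expChar, smul_pow, smul_pow, smul_pow, ZMod.pow_card,
    ZMod.pow_card, ZMod.pow_card_sub_one_eq_one hT0, hx]
  simp only [one_smul, mul_add, smul_sub, mul_smul_comm]
  ring

theorem exists_algHom_of_row (S : Set (Matrix (Fin 3) (Fin 3) (ZMod p)))
    (h0 : ∀ T ∈ S, polyAct T (X 0) = T 0 0 • X 0) (hT0 : ∀ T ∈ S, T 0 0 ≠ 0)
    {i : Fin 3} (hi : i ≠ 0) (hT : ∀ T ∈ S, ∀ j, j ≠ 0 → j ≠ i → T i j = 0)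
    (h : (∀ T ∈ S, T i 0 = 0) ∨ Matrix.transvection i 0 1 ∈ S) :
    ∃ τ : MvPolynomial (Fin 3) (ZMod p) →ₐ[ZMod p] MvPolynomial (Fin 3) (ZMod p),
      Function.Injective τ ∧ (∀ k, k ≠ i → τ (X k) = X k) ∧
      (∀ T ∈ S, polyAct T (τ (X i)) = T i i • τ (X i)) ∧
      (∀ σ : MvPolynomial (Fin 3) (ZMod p) →ₐ[ZMod p] MvPolynomial (Fin 3) (ZMod p),
        σ (X 0) = X 0 → σ (X i) = X i → σ (τ (X i)) = τ (X i)) ∧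
      ∀ f, (Matrix.transvection i 0 1 ∈ S → polyAct (Matrix.transvection i 0 1) f = f) →
        ∃ q, τ q = f := by
  rcases h with h | h
  · refine ⟨AlgHom.id _ _, Function.injective_id, fun k _ => rfl, fun T hTS => ?_,
      fun σ _ hσ => hσ, fun f _ => ⟨f, rfl⟩⟩
    rw [AlgHom.id_apply, polyAct_X_eq_of_row hi T (hT T hTS), h T hTS, zero_smul, zero_add]
  · refine ⟨artinSchreierHom (ZMod p) p i 0, artinSchreierHom_injective hi.symm, fun k hk => ?_,
      fun T hTS => polyAct_artinSchreierHom_X hi T (h0 T hTS) (hT0 T hTS) (hT T hTS),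
      fun σ hσ0 hσi => ?_, fun f hf => mem_range_artinSchreierHom hi.symm f (hf h)⟩
    · rw [artinSchreierHom, aeval_X, if_neg hk]
    · rw [artinSchreierHom, aeval_X, if_pos rfl, map_sub, map_mul, map_pow, map_pow, hσ0, hσi]

theorem nonempty_ringEquiv_diagonal (S : Set (Matrix (Fin 3) (Fin 3) (ZMod p)))
    (h0 : ∀ T ∈ S, ∀ j, j ≠ 0 → T 0 j = 0) (hT0 : ∀ T ∈ S, T 0 0 ≠ 0)
    (hrow : ∀ i, i ≠ 0 → ∀ T ∈ S, ∀ j, j ≠ 0 → j ≠ i → T i j = 0)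
    (h : ∀ i, i ≠ 0 → (∀ T ∈ S, T i 0 = 0) ∨ Matrix.transvection i 0 1 ∈ S) :
    Nonempty (invariantAlg (Matrix.diagonal '' (Matrix.diag '' S)) ≃+* invariantAlg S) := by
  have h0' : ∀ T ∈ S, polyAct T (X 0) = T 0 0 • X 0 := fun T hT => by
    rw [polyAct_X, Finset.sum_eq_single 0]
    · intro j _ hj
      rw [h0 T hT j hj, zero_smul]
    · exact fun h => absurd (Finset.mem_univ _) h
  have h10 : (1 : Fin 3) ≠ 0 := by decide
  have h20 : (2 : Fin 3) ≠ 0 := by decide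
  have h12 : (1 : Fin 3) ≠ 2 := by decide
  obtain ⟨τ₁, inj₁, fix₁, act₁, nat₁, surj₁⟩ :=
    exists_algHom_of_row S h0' hT0 h10 (hrow 1 h10) (h 1 h10)
  obtain ⟨τ₂, inj₂, fix₂, act₂, nat₂, surj₂⟩ :=
    exists_algHom_of_row S h0' hT0 h20 (hrow 2 h20) (h 2 h20)
  obtain ⟨τ, hτ⟩ : ∃ τ : MvPolynomial (Fin 3) (ZMod p) →ₐ[ZMod p] MvPolynomial (Fin 3) (ZMod p),
      ∀ f, τ f = τ₁ (τ₂ f) := ⟨τ₁.comp τ₂, fun _ => rfl⟩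
  have hτ0 : τ (X 0) = X 0 := by rw [hτ, fix₂ 0 h20.symm, fix₁ 0 h10.symm]
  have hτ1 : τ (X 1) = τ₁ (X 1) := by rw [hτ, fix₂ 1 h12]
  have hτ2 : τ (X 2) = τ₂ (X 2) := by
    rw [hτ, nat₂ τ₁ (fix₁ 0 h10.symm) (fix₁ 2 h12.symm)]
  have hτinj : Function.Injective τ := fun f g hfg => inj₂ (inj₁ (by rwa [hτ, hτ] at hfg))
  have hact : ∀ T ∈ S, ∀ f, polyAct T (τ f) = τ (polyAct (Matrix.diagonal (Matrix.diag T)) f) := by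
    intro T hT
    refine fun f => DFunLike.congr_fun (?_ : (polyAct T).comp τ = τ.comp (polyAct _)) f
    refine MvPolynomial.algHom_ext fun k => ?_
    rw [AlgHom.comp_apply, AlgHom.comp_apply]
    have hd : polyAct (Matrix.diagonal (Matrix.diag T)) (X k) = T k k • X k := by
      rw [polyAct_X, Finset.sum_eq_single k]
      · rw [Matrix.diagonal_apply_eq, Matrix.diag_apply]
      · intro j _ hj
        rw [Matrix.diagonal_apply_ne' _ hj, zero_smul]
      · exact fun h => absurd (Finset.mem_univ _) h
    rw [hd, map_smul]
    fin_cases k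
    · exact hτ0.symm ▸ h0' T hT
    · exact hτ1.symm ▸ act₁ T hT
    · exact hτ2.symm ▸ act₂ T hT
  have hmem : ∀ f, τ f ∈ invariantAlg S ↔
      f ∈ invariantAlg (Matrix.diagonal '' (Matrix.diag '' S)) := by
    intro f
    change (∀ T ∈ S, polyAct T (τ f) = τ f) ↔
      ∀ T ∈ Matrix.diagonal '' (Matrix.diag '' S), polyAct T f = f
    rw [Set.forall_mem_image, Set.forall_mem_image]
    exact forall₂_congr fun T hT => by rw [hact T hT, hτinj.eq_iff]
  have hcomm : ∀ q, τ₁ (polyAct (Matrix.transvection 2 0 1) q) =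
      polyAct (Matrix.transvection 2 0 1) (τ₁ q) := by
    have hE : ∀ k, polyAct (Matrix.transvection (2 : Fin 3) 0 (1 : ZMod p)) (X k) =
      X k + if k = 2 then X 0 else 0 := fun k => polyAct_transvection_X k
    generalize polyAct (Matrix.transvection (2 : Fin 3) 0 (1 : ZMod p)) = E at hE
    refine fun q => DFunLike.congr_fun (?_ : τ₁.comp E = E.comp τ₁) q
    refine MvPolynomial.algHom_ext fun k => ?_
    rw [AlgHom.comp_apply, AlgHom.comp_apply]
    by_cases hk : k = 1
    · subst hk
      have hE1 := hE 1
      rw [if_neg h12, add_zero] at hE1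
      have hE0 := hE 0
      rw [if_neg h20.symm, add_zero] at hE0
      rw [hE1, nat₁ E hE0 hE1]
    · rw [fix₁ k hk, hE, map_add, fix₁ k hk]
      split_ifs
      · rw [fix₁ 0 h10.symm]
      · rw [map_zero]
  have hsurj : ∀ f ∈ invariantAlg S, ∃ q, τ q = f := by
    intro f hf
    obtain ⟨q, rfl⟩ := surj₁ f fun hE => hf _ hE
    obtain ⟨q, rfl⟩ := surj₂ q fun hE => inj₁ ((hcomm q).trans (hf _ hE))
    exact ⟨q, hτ q⟩
  let φ := (τ.comp (invariantAlg (Matrix.diagonal '' (Matrix.diag '' S))).val).codRestrict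
    (invariantAlg S) fun f => (hmem f).2 f.2
  have hφ : ∀ f, (φ f : MvPolynomial (Fin 3) (ZMod p)) = τ f := fun f => rfl
  clear_value φ
  refine ⟨RingEquiv.ofBijective φ ⟨fun f g hfg => ?_, fun f => ?_⟩⟩
  · exact Subtype.ext (hτinj (by rw [← hφ, ← hφ, hfg]))
  · obtain ⟨q, hq⟩ := hsurj f f.2
    exact ⟨⟨q, (hmem q).1 (hq ▸ f.2)⟩, Subtype.ext ((hφ _).trans hq)⟩

end Triangular

section Conjugation

theorem polyAct_mul {F : Type u} [Field F] {m : ℕ} (M N : Matrix (Fin m) (Fin m) F)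
    (f : MvPolynomial (Fin m) F) : polyAct (N * M) f = polyAct M (polyAct N f) := by
  refine DFunLike.congr_fun (?_ : polyAct (N * M) = (polyAct M).comp (polyAct N)) f
  refine MvPolynomial.algHom_ext fun i => ?_
  rw [AlgHom.comp_apply, polyAct_X, polyAct_X, map_sum]
  simp only [map_smul, polyAct_X, Finset.smul_sum, Matrix.mul_apply, Finset.sum_smul, mul_smul]
  exact Finset.sum_comm

theorem polyAct_one {F : Type u} [Field F] {m : ℕ} (f : MvPolynomial (Fin m) F) :
    polyAct (1 : Matrix (Fin m) (Fin m) F) f = f := by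
  refine DFunLike.congr_fun (?_ : polyAct 1 = AlgHom.id F _) f
  refine MvPolynomial.algHom_ext fun i => ?_
  rw [polyAct_X, AlgHom.id_apply, Finset.sum_eq_single i]
  · rw [Matrix.one_apply_eq, one_smul]
  · intro j _ hj
    rw [Matrix.one_apply_ne' hj, zero_smul]
  · exact fun h => absurd (Finset.mem_univ _) h

theorem polyAct_polyAct_of_mul_eq_one {F : Type u} [Field F] {m : ℕ}
    {M N : Matrix.SpecialLinearGroup (Fin m) F} (h : N * M = 1) (f : MvPolynomial (Fin m) F) :
    polyAct (M : Matrix (Fin m) (Fin m) F) (polyAct (N : Matrix (Fin m) (Fin m) F) f) = f := by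
  rw [← polyAct_mul, ← Matrix.SpecialLinearGroup.coe_mul, h, Matrix.SpecialLinearGroup.coe_one,
    polyAct_one]

/-- Conjugate groups have isomorphic rings of invariants. -/
theorem nonempty_ringEquiv_invariantRing_conj {F : Type u} [Field F] {m : ℕ}
    (G : Subgroup (Matrix.SpecialLinearGroup (Fin m) F)) (P : Matrix.SpecialLinearGroup (Fin m) F) :
    Nonempty (invariantRing (G.map (MulAut.conj P).toMonoidHom) ≃+* invariantRing G) := by
  have hinj : Function.Injective (polyAct (P : Matrix (Fin m) (Fin m) F)) :=
    Function.LeftInverse.injective (polyAct_polyAct_of_mul_eq_one (mul_inv_cancel P))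
  have hmem : ∀ f, polyAct (P : Matrix (Fin m) (Fin m) F) f ∈ invariantRing G ↔
      f ∈ invariantRing (G.map (MulAut.conj P).toMonoidHom) := by
    intro f
    change (∀ M, (∃ g ∈ G, (g : Matrix (Fin m) (Fin m) F) = M) → _) ↔
      ∀ M, (∃ g ∈ G.map (MulAut.conj P).toMonoidHom, (g : Matrix (Fin m) (Fin m) F) = M) → _
    simp only [Subgroup.mem_map, forall_exists_index, and_imp, forall_apply_eq_imp_iff₂]
    refine forall₂_congr fun g _ => ?_
    have hconj : P * g = MulAut.conj P g * P := by simp [MulAut.conj_apply]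
    rw [← polyAct_mul, ← Matrix.SpecialLinearGroup.coe_mul, hconj,
      Matrix.SpecialLinearGroup.coe_mul, polyAct_mul, hinj.eq_iff]
    rfl
  let φ := ((polyAct (P : Matrix (Fin m) (Fin m) F)).comp
    (invariantRing (G.map (MulAut.conj P).toMonoidHom)).val).codRestrict
    (invariantRing G) fun f => (hmem f).2 f.2
  have hφ : ∀ f, (φ f : MvPolynomial (Fin m) F) = polyAct (P : Matrix (Fin m) (Fin m) F) f :=
    fun f => rfl
  clear_value φ
  refine ⟨RingEquiv.ofBijective φ ⟨fun f g hfg => ?_, fun f => ?_⟩⟩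
  · exact Subtype.ext (hinj (by rw [← hφ, ← hφ, hfg]))
  · have hq := polyAct_polyAct_of_mul_eq_one (inv_mul_cancel P) (f : MvPolynomial (Fin m) F)
    exact ⟨⟨_, (hmem _).1 (hq.symm ▸ f.2)⟩, Subtype.ext ((hφ _).trans hq)⟩

end Conjugation

section Arrow

variable {F : Type u} [Field F]

/-- All entries of a `3 × 3` matrix outside the diagonal and the first column vanish. -/
def IsArrow (M : Matrix (Fin 3) (Fin 3) F) : Prop :=
  M 0 1 = 0 ∧ M 0 2 = 0 ∧ M 1 2 = 0 ∧ M 2 1 = 0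

namespace IsArrow

variable {M N : Matrix (Fin 3) (Fin 3) F}

theorem apply_eq_zero (hM : IsArrow M) {i j : Fin 3} (hj : j ≠ 0) (hij : j ≠ i) : M i j = 0 := by
  obtain ⟨h1, h2, h3, h4⟩ := hM
  fin_cases i <;> fin_cases j <;> first | exact absurd rfl hj | exact absurd rfl hij | assumption

theorem mul_apply_self (hM : IsArrow M) (hN : IsArrow N) (i : Fin 3) :
    (M * N) i i = M i i * N i i := by
  obtain ⟨h1, h2, h3, h4⟩ := hM
  obtain ⟨h1', h2', h3', h4'⟩ := hN
  fin_cases i <;> simp [Matrix.mul_apply, Fin.sum_univ_three, *]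

theorem mul_apply_zero (hM : IsArrow M) {i : Fin 3} (hi : i ≠ 0) :
    (M * N) i 0 = M i 0 * N 0 0 + M i i * N i 0 := by
  obtain ⟨h1, h2, h3, h4⟩ := hM
  fin_cases i
  · exact absurd rfl hi
  all_goals simp [Matrix.mul_apply, Fin.sum_univ_three, *]

theorem det_eq (hM : IsArrow M) : M.det = ∏ i, M i i := by
  obtain ⟨h1, h2, h3, h4⟩ := hM
  simp [Matrix.det_fin_three, Fin.prod_univ_three, *]

theorem apply_self_ne_zero {g : Matrix.SpecialLinearGroup (Fin 3) F}
    (hg : IsArrow (g : Matrix (Fin 3) (Fin 3) F)) (i : Fin 3) :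
    (g : Matrix (Fin 3) (Fin 3) F) i i ≠ 0 := by
  have h := hg.det_eq
  rw [g.det_coe] at h
  exact Finset.prod_ne_zero_iff.1 (h.symm.trans_ne one_ne_zero) i (Finset.mem_univ i)

end IsArrow

/-- A unipotent element of a group of arrow matrices: all diagonal entries are `1`. -/
def IsUnip (G : Subgroup (Matrix.SpecialLinearGroup (Fin 3) F))
    (u : Matrix.SpecialLinearGroup (Fin 3) F) : Prop :=
  u ∈ G ∧ ∀ k, (u : Matrix (Fin 3) (Fin 3) F) k k = 1

section

variable {G : Subgroup (Matrix.SpecialLinearGroup (Fin 3) F)}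

theorem IsUnip.mul
    (hG : ∀ g ∈ G, IsArrow (g : Matrix (Fin 3) (Fin 3) F))
    {u v : Matrix.SpecialLinearGroup (Fin 3) F} (hu : IsUnip G u)
    (hv : IsUnip G v) : IsUnip G (u * v) := by
  refine ⟨G.mul_mem hu.1 hv.1, fun k => ?_⟩
  rw [Matrix.SpecialLinearGroup.coe_mul, (hG u hu.1).mul_apply_self (hG v hv.1), hu.2, hv.2,
    one_mul]

theorem IsUnip.mul_apply_zero
    (hG : ∀ g ∈ G, IsArrow (g : Matrix (Fin 3) (Fin 3) F))
    {u v : Matrix.SpecialLinearGroup (Fin 3) F} (hu : IsUnip G u)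
    (hv : IsUnip G v) {i : Fin 3} (hi : i ≠ 0) :
    ((u * v : Matrix.SpecialLinearGroup (Fin 3) F) : Matrix (Fin 3) (Fin 3) F) i 0 =
      (u : Matrix (Fin 3) (Fin 3) F) i 0 + (v : Matrix (Fin 3) (Fin 3) F) i 0 := by
  rw [Matrix.SpecialLinearGroup.coe_mul, (hG u hu.1).mul_apply_zero hi, hu.2, hv.2, one_mul,
    mul_one]

theorem IsUnip.pow
    (hG : ∀ g ∈ G, IsArrow (g : Matrix (Fin 3) (Fin 3) F))
    {u : Matrix.SpecialLinearGroup (Fin 3) F} (hu : IsUnip G u) (n : ℕ) :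
    IsUnip G (u ^ n) ∧ ∀ i ≠ 0,
      ((u ^ n : Matrix.SpecialLinearGroup (Fin 3) F) : Matrix (Fin 3) (Fin 3) F) i 0 =
        n * (u : Matrix (Fin 3) (Fin 3) F) i 0 := by
  induction n with
  | zero =>
    refine ⟨⟨pow_zero u ▸ G.one_mem, fun k => ?_⟩, fun i hi => ?_⟩
    · rw [pow_zero, Matrix.SpecialLinearGroup.coe_one, Matrix.one_apply_eq]
    · rw [pow_zero, Matrix.SpecialLinearGroup.coe_one, Matrix.one_apply_ne hi, Nat.cast_zero,
        zero_mul]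
  | succ n ih =>
    rw [pow_succ]
    refine ⟨ih.1.mul hG hu, fun i hi => ?_⟩
    rw [ih.1.mul_apply_zero hG hu hi, ih.2 i hi, Nat.cast_succ, add_mul, one_mul]

/-- The unipotent elements contain the commutators. -/
theorem isUnip_of_mul_eq
    (hG : ∀ g ∈ G, IsArrow (g : Matrix (Fin 3) (Fin 3) F))
    {u g h : Matrix.SpecialLinearGroup (Fin 3) F} (hu : u * (h * g) = g * h)
    (hg : g ∈ G) (hh : h ∈ G) : IsUnip G u := by
  have huG : u ∈ G := eq_mul_inv_of_mul_eq hu ▸ G.mul_mem (G.mul_mem hg hh)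
    (G.inv_mem (G.mul_mem hh hg))
  refine ⟨huG, fun k => ?_⟩
  have h1 := congrArg (fun x : Matrix.SpecialLinearGroup (Fin 3) F =>
    (x : Matrix (Fin 3) (Fin 3) F) k k) hu
  simp only [Matrix.SpecialLinearGroup.coe_mul] at h1
  have hhg := hG _ (G.mul_mem hh hg)
  rw [Matrix.SpecialLinearGroup.coe_mul] at hhg
  rw [(hG u huG).mul_apply_self hhg, (hG h hh).mul_apply_self (hG g hg),
    (hG g hg).mul_apply_self (hG h hh)] at h1
  exact mul_right_cancel₀ (mul_ne_zero ((hG h hh).apply_self_ne_zero k)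
    ((hG g hg).apply_self_ne_zero k)) (h1.trans (by ring))

/-- A unipotent `u` and a group element `g` give the unipotent `g * u * g⁻¹`. -/
theorem IsUnip.exists_conj
    (hG : ∀ g ∈ G, IsArrow (g : Matrix (Fin 3) (Fin 3) F))
    {u g : Matrix.SpecialLinearGroup (Fin 3) F} (hu : IsUnip G u)
    (hg : g ∈ G) : ∃ v, IsUnip G v ∧ ∀ i ≠ 0,
      (v : Matrix (Fin 3) (Fin 3) F) i 0 * (g : Matrix (Fin 3) (Fin 3) F) 0 0 =
        (g : Matrix (Fin 3) (Fin 3) F) i i * (u : Matrix (Fin 3) (Fin 3) F) i 0 := by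
  have hv : g * u * g⁻¹ * g = g * u := inv_mul_cancel_right _ _
  have hvG : g * u * g⁻¹ ∈ G := G.mul_mem (G.mul_mem hg hu.1) (G.inv_mem hg)
  generalize g * u * g⁻¹ = v at hv hvG
  have hv' := fun i j : Fin 3 => congrArg (fun x : Matrix.SpecialLinearGroup (Fin 3) F =>
    (x : Matrix (Fin 3) (Fin 3) F) i j) hv
  simp only [Matrix.SpecialLinearGroup.coe_mul] at hv'
  have hd : ∀ k, (v : Matrix (Fin 3) (Fin 3) F) k k = 1 := by
    intro k
    have h1 := hv' k k
    rw [(hG v hvG).mul_apply_self (hG g hg), (hG g hg).mul_apply_self (hG u hu.1), hu.2] at h1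
    exact mul_right_cancel₀ ((hG g hg).apply_self_ne_zero k) (h1.trans (mul_comm _ _))
  refine ⟨v, ⟨hvG, hd⟩, fun i hi => ?_⟩
  have h1 := hv' i 0
  rw [(hG v hvG).mul_apply_zero hi, (hG g hg).mul_apply_zero hi, hd, hu.2] at h1
  linear_combination h1

end

end Arrow

section ArrowGroup

variable {p : ℕ} [Fact p.Prime] {G : Subgroup (Matrix.SpecialLinearGroup (Fin 3) (ZMod p))}

/-- A row whose unipotent part is trivial can be diagonalised. -/
theorem exists_coboundary
    (hG : ∀ g ∈ G, IsArrow (g : Matrix (Fin 3) (Fin 3) (ZMod p))) {i : Fin 3} (hi : i ≠ 0)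
    (h : ∀ u, IsUnip G u → (u : Matrix (Fin 3) (Fin 3) (ZMod p)) i 0 = 0) :
    ∃ t, ∀ g ∈ G, (g : Matrix (Fin 3) (Fin 3) (ZMod p)) i 0 =
      t * ((g : Matrix (Fin 3) (Fin 3) (ZMod p)) i i -
        (g : Matrix (Fin 3) (Fin 3) (ZMod p)) 0 0) := by
  have hcomm : ∀ g ∈ G, ∀ k ∈ G, ((g : Matrix (Fin 3) (Fin 3) (ZMod p)) * k) i 0 =
      ((k : Matrix (Fin 3) (Fin 3) (ZMod p)) * g) i 0 := by
    intro g hg k hk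
    have hu : g * k * (k * g)⁻¹ * (k * g) = g * k := inv_mul_cancel_right _ _
    have hU := isUnip_of_mul_eq hG hu hg hk
    rw [← Matrix.SpecialLinearGroup.coe_mul, ← hu, Matrix.SpecialLinearGroup.coe_mul,
      (hG _ hU.1).mul_apply_zero hi, h _ hU, hU.2, zero_mul, zero_add, one_mul,
      Matrix.SpecialLinearGroup.coe_mul]
  by_cases hd : ∀ g ∈ G, (g : Matrix (Fin 3) (Fin 3) (ZMod p)) i i =
      (g : Matrix (Fin 3) (Fin 3) (ZMod p)) 0 0
  · refine ⟨0, fun g hg => ?_⟩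
    have hpow : ∀ n : ℕ, g ^ n ∈ G ∧ (∀ k, ((g ^ n : Matrix.SpecialLinearGroup (Fin 3) (ZMod p)) :
        Matrix (Fin 3) (Fin 3) (ZMod p)) k k = (g : Matrix (Fin 3) (Fin 3) (ZMod p)) k k ^ n) ∧
        (g : Matrix (Fin 3) (Fin 3) (ZMod p)) 0 0 *
          ((g ^ n : Matrix.SpecialLinearGroup (Fin 3) (ZMod p)) :
            Matrix (Fin 3) (Fin 3) (ZMod p)) i 0 =
          n * (g : Matrix (Fin 3) (Fin 3) (ZMod p)) 0 0 ^ n *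
            (g : Matrix (Fin 3) (Fin 3) (ZMod p)) i 0 := by
      intro n
      induction n with
      | zero => simp [Matrix.one_apply_ne hi, G.one_mem]
      | succ n ih =>
        obtain ⟨h1, h2, h3⟩ := ih
        refine ⟨pow_succ g n ▸ G.mul_mem h1 hg, fun k => ?_, ?_⟩
        · rw [pow_succ, Matrix.SpecialLinearGroup.coe_mul, (hG _ h1).mul_apply_self (hG g hg), h2,
            pow_succ]
        · rw [pow_succ, Matrix.SpecialLinearGroup.coe_mul, (hG _ h1).mul_apply_zero hi, h2,
            hd g hg]
          push_cast
          linear_combination (g : Matrix (Fin 3) (Fin 3) (ZMod p)) 0 0 * h3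
    obtain ⟨h1, h2, h3⟩ := hpow (p - 1)
    have hone := fun k => ZMod.pow_card_sub_one_eq_one ((hG g hg).apply_self_ne_zero k)
    rw [h _ ⟨h1, fun k => (h2 k).trans (hone k)⟩, hone, mul_zero, mul_one,
      Nat.cast_sub (Fact.out : p.Prime).one_le, Nat.cast_one, CharP.cast_eq_zero] at h3
    linear_combination h3
  · push Not at hd
    obtain ⟨k, hk, hne⟩ := hd
    have hne' := sub_ne_zero.2 hne
    refine ⟨(k : Matrix (Fin 3) (Fin 3) (ZMod p)) i 0 /
      ((k : Matrix (Fin 3) (Fin 3) (ZMod p)) i i - (k : Matrix (Fin 3) (Fin 3) (ZMod p)) 0 0),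
      fun g hg => ?_⟩
    have h1 := hcomm g hg k hk
    rw [(hG g hg).mul_apply_zero hi, (hG k hk).mul_apply_zero hi] at h1
    field_simp
    linear_combination -h1

end ArrowGroup

section ArrowGroupConj

variable {p : ℕ} [Fact p.Prime] {G : Subgroup (Matrix.SpecialLinearGroup (Fin 3) (ZMod p))}

/-- There is a unipotent element which is supported on the row `i`. -/
def HasUnipRow (G : Subgroup (Matrix.SpecialLinearGroup (Fin 3) (ZMod p))) (i : Fin 3) : Prop :=
  ∃ u, IsUnip G u ∧ (u : Matrix (Fin 3) (Fin 3) (ZMod p)) i 0 ≠ 0 ∧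
    ∀ j, j ≠ 0 → j ≠ i → (u : Matrix (Fin 3) (Fin 3) (ZMod p)) j 0 = 0

theorem HasUnipRow.exists_transvection
    (hG : ∀ g ∈ G, IsArrow (g : Matrix (Fin 3) (Fin 3) (ZMod p))) {i : Fin 3} (hi : i ≠ 0)
    (h : HasUnipRow G i) :
    ∃ g ∈ G, (g : Matrix (Fin 3) (Fin 3) (ZMod p)) = Matrix.transvection i 0 1 := by
  obtain ⟨u, hu, hne, h0⟩ := h
  obtain ⟨hU, hrow⟩ := hu.pow hG (((u : Matrix (Fin 3) (Fin 3) (ZMod p)) i 0)⁻¹).val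
  refine ⟨_, hU.1, ?_⟩
  ext j k
  rw [Matrix.transvection, Matrix.add_apply]
  by_cases hk : k = 0
  · subst hk
    by_cases hj : j = 0
    · subst hj
      rw [hU.2, Matrix.one_apply_eq, Matrix.single_apply_of_ne _ _ _ _ _ (by simp [hi]), add_zero]
    · rw [hrow j hj, Matrix.one_apply_ne hj, zero_add, ZMod.natCast_zmod_val]
      by_cases hij : j = i
      · subst hij
        rw [inv_mul_cancel₀ hne, Matrix.single_apply_same]
      · rw [h0 j hj hij, mul_zero,
          Matrix.single_apply_of_ne _ _ _ _ _ fun hc => hij hc.1.symm]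
  · rw [Matrix.single_apply_of_ne _ _ _ _ _ fun hc => hk hc.2.symm, add_zero]
    by_cases hjk : k = j
    · subst hjk
      rw [hU.2, Matrix.one_apply_eq]
    · rw [(hG _ hU.1).apply_eq_zero hk hjk, Matrix.one_apply_ne' hjk]

/-- If only the row `i` supports a unipotent element, then all unipotent elements are supported
there. -/
theorem HasUnipRow.apply_eq_zero
    (hG : ∀ g ∈ G, IsArrow (g : Matrix (Fin 3) (Fin 3) (ZMod p))) {i j : Fin 3} (hi : i ≠ 0)
    (hj : j ≠ 0) (hij : i ≠ j) (h : HasUnipRow G i) (h' : ¬ HasUnipRow G j)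
    {v : Matrix.SpecialLinearGroup (Fin 3) (ZMod p)} (hv : IsUnip G v) :
    (v : Matrix (Fin 3) (Fin 3) (ZMod p)) j 0 = 0 := by
  by_contra hne
  obtain ⟨u, hu, hui, h0⟩ := h
  obtain ⟨hU, hrow⟩ := hu.pow hG (-(v : Matrix (Fin 3) (Fin 3) (ZMod p)) i 0 /
    (u : Matrix (Fin 3) (Fin 3) (ZMod p)) i 0).val
  rw [ZMod.natCast_zmod_val] at hrow
  refine h' ⟨_, hv.mul hG hU, ?_, fun k hk hkj => ?_⟩
  · rwa [hv.mul_apply_zero hG hU hj, hrow j hj, h0 j hj hij.symm, mul_zero, add_zero]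
  · have hki : k = i := by omega
    subst hki
    rw [hv.mul_apply_zero hG hU hk, hrow k hk, div_mul_cancel₀ _ hui, add_neg_cancel]

/-- If no row supports a unipotent element on its own, but there is a nontrivial unipotent
element, then the last two diagonal entries agree. -/
theorem apply_self_eq_of_not_hasUnipRow
    (hG : ∀ g ∈ G, IsArrow (g : Matrix (Fin 3) (Fin 3) (ZMod p))) (h2 : ¬ HasUnipRow G 2)
    {u : Matrix.SpecialLinearGroup (Fin 3) (ZMod p)} (hu : IsUnip G u)
    (hu2 : (u : Matrix (Fin 3) (Fin 3) (ZMod p)) 2 0 ≠ 0)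
    {g : Matrix.SpecialLinearGroup (Fin 3) (ZMod p)} (hg : g ∈ G) :
    (g : Matrix (Fin 3) (Fin 3) (ZMod p)) 1 1 = (g : Matrix (Fin 3) (Fin 3) (ZMod p)) 2 2 := by
  have h10 : (1 : Fin 3) ≠ 0 := by decide
  have h20 : (2 : Fin 3) ≠ 0 := by decide
  by_contra hne
  have hg0 := (hG g hg).apply_self_ne_zero 0
  obtain ⟨v, hv, hrow⟩ := hu.exists_conj hG hg
  obtain ⟨hU, hrow'⟩ := hu.pow hG (-((g : Matrix (Fin 3) (Fin 3) (ZMod p)) 1 1 /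
    (g : Matrix (Fin 3) (Fin 3) (ZMod p)) 0 0)).val
  rw [ZMod.natCast_zmod_val] at hrow'
  have hrow₁ := fun i hi => eq_div_of_mul_eq hg0 (hrow i hi)
  refine h2 ⟨_, hv.mul hG hU, ?_, fun k hk hkj => ?_⟩
  · rw [hv.mul_apply_zero hG hU h20, hrow₁ 2 h20, hrow' 2 h20]
    have : (g : Matrix (Fin 3) (Fin 3) (ZMod p)) 2 2 * (u : Matrix (Fin 3) (Fin 3) (ZMod p)) 2 0 /
        (g : Matrix (Fin 3) (Fin 3) (ZMod p)) 0 0 +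
        -((g : Matrix (Fin 3) (Fin 3) (ZMod p)) 1 1 / (g : Matrix (Fin 3) (Fin 3) (ZMod p)) 0 0) *
          (u : Matrix (Fin 3) (Fin 3) (ZMod p)) 2 0 =
        ((g : Matrix (Fin 3) (Fin 3) (ZMod p)) 2 2 - (g : Matrix (Fin 3) (Fin 3) (ZMod p)) 1 1) *
          (u : Matrix (Fin 3) (Fin 3) (ZMod p)) 2 0 /
            (g : Matrix (Fin 3) (Fin 3) (ZMod p)) 0 0 := by ring
    rw [this]
    exact div_ne_zero (mul_ne_zero (sub_ne_zero.2 (Ne.symm hne)) hu2) hg0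
  · have hk1 : k = 1 := by omega
    subst hk1
    rw [hv.mul_apply_zero hG hU h10, hrow₁ 1 h10, hrow' 1 h10]
    ring

/-- A lower unitriangular matrix. -/
def lowerUnitri {F : Type u} [Field F] (c e f : F) : Matrix.SpecialLinearGroup (Fin 3) F :=
  ⟨!![1, 0, 0; c, 1, 0; e, f, 1], by simp [Matrix.det_fin_three]⟩

theorem lowerUnitri_mul {F : Type u} [Field F] (c e f c' e' f' : F) :
    lowerUnitri c e f * lowerUnitri c' e' f' =
      lowerUnitri (c + c') (e + f * c' + e') (f + f') := by
  ext i j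
  rw [Matrix.SpecialLinearGroup.coe_mul]
  simp only [lowerUnitri]
  fin_cases i <;> fin_cases j <;> simp [Matrix.mul_apply, Fin.sum_univ_three, add_assoc]

theorem lowerUnitri_inv {F : Type u} [Field F] (c e f : F) :
    (lowerUnitri c e f)⁻¹ = lowerUnitri (-c) (f * c - e) (-f) := by
  refine inv_eq_of_mul_eq_one_right ?_
  rw [lowerUnitri_mul]
  ext i j
  simp only [lowerUnitri]
  fin_cases i <;> fin_cases j <;> simp
  ring

theorem coe_lowerUnitri_conj {F : Type u} [Field F] (c e f : F)
    {g : Matrix.SpecialLinearGroup (Fin 3) F} (hg : IsArrow (g : Matrix (Fin 3) (Fin 3) F)) :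
    (MulAut.conj (lowerUnitri c e f) g : Matrix.SpecialLinearGroup (Fin 3) F) =
      !![g.1 0 0, 0, 0;
        c * g.1 0 0 + g.1 1 0 - c * g.1 1 1, g.1 1 1, 0;
        e * g.1 0 0 + f * g.1 1 0 + g.1 2 0 - f * c * g.1 1 1 + (f * c - e) * g.1 2 2,
        f * g.1 1 1 - f * g.1 2 2, g.1 2 2] := by
  obtain ⟨h1, h2, h3, h4⟩ := hg
  rw [MulAut.conj_apply, lowerUnitri_inv, Matrix.SpecialLinearGroup.coe_mul,
    Matrix.SpecialLinearGroup.coe_mul]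
  simp only [lowerUnitri]
  ext i j
  simp only [Matrix.mul_apply, Fin.sum_univ_three]
  fin_cases i <;> fin_cases j <;> simp [*] <;> ring

end ArrowGroupConj

section ArrowNormalForm

variable {p : ℕ} [Fact p.Prime] {G : Subgroup (Matrix.SpecialLinearGroup (Fin 3) (ZMod p))}

theorem exists_coboundary_or_transvection
    (hG : ∀ g ∈ G, IsArrow (g : Matrix (Fin 3) (Fin 3) (ZMod p)))
    (h : HasUnipRow G 1 ∨ HasUnipRow G 2 ∨
      ∀ u, IsUnip G u → ∀ i ≠ 0, (u : Matrix (Fin 3) (Fin 3) (ZMod p)) i 0 = 0)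
    {i : Fin 3} (hi : i ≠ 0) :
    (∃ t, ∀ g ∈ G, (g : Matrix (Fin 3) (Fin 3) (ZMod p)) i 0 =
      t * ((g : Matrix (Fin 3) (Fin 3) (ZMod p)) i i -
        (g : Matrix (Fin 3) (Fin 3) (ZMod p)) 0 0)) ∨
      ∃ g ∈ G, (g : Matrix (Fin 3) (Fin 3) (ZMod p)) = Matrix.transvection i 0 1 := by
  by_cases hrow : HasUnipRow G i
  · exact Or.inr (hrow.exists_transvection hG hi)
  · refine Or.inl (exists_coboundary hG hi fun u hu => ?_)
    have hne : ∀ j, HasUnipRow G j → j ≠ i := fun j hj hji => hrow (hji ▸ hj)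
    rcases h with h | h | h
    · exact h.apply_eq_zero hG (by decide) hi (hne _ h) hrow hu
    · exact h.apply_eq_zero hG (by decide) hi (hne _ h) hrow hu
    · exact h u hu i hi

theorem isArrow_lowerUnitri_conj {F : Type u} [Field F] {c e f : F}
    {g : Matrix.SpecialLinearGroup (Fin 3) F} (hg : IsArrow (g : Matrix (Fin 3) (Fin 3) F))
    (h : f * (g : Matrix (Fin 3) (Fin 3) F) 1 1 = f * (g : Matrix (Fin 3) (Fin 3) F) 2 2) :
    IsArrow (MulAut.conj (lowerUnitri c e f) g : Matrix.SpecialLinearGroup (Fin 3) F).1 := by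
  rw [coe_lowerUnitri_conj c e f hg]
  exact ⟨rfl, rfl, rfl, sub_eq_zero.2 h⟩

theorem exists_conj_hasUnipRow (hG : ∀ g ∈ G, IsArrow (g : Matrix (Fin 3) (Fin 3) (ZMod p))) :
    ∃ P : Matrix.SpecialLinearGroup (Fin 3) (ZMod p),
      (∀ g ∈ G.map (MulAut.conj P).toMonoidHom,
        IsArrow (g : Matrix (Fin 3) (Fin 3) (ZMod p))) ∧
      (HasUnipRow (G.map (MulAut.conj P).toMonoidHom) 1 ∨
        HasUnipRow (G.map (MulAut.conj P).toMonoidHom) 2 ∨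
        ∀ u, IsUnip (G.map (MulAut.conj P).toMonoidHom) u → ∀ i ≠ 0,
          (u : Matrix (Fin 3) (Fin 3) (ZMod p)) i 0 = 0) := by
  by_cases htriv : HasUnipRow G 1 ∨ HasUnipRow G 2 ∨
      ∀ u, IsUnip G u → ∀ i ≠ 0, (u : Matrix (Fin 3) (Fin 3) (ZMod p)) i 0 = 0
  · have hone : G.map (MulAut.conj (1 : Matrix.SpecialLinearGroup (Fin 3) (ZMod p))).toMonoidHom =
        G := by
      rw [map_one]
      exact G.map_id
    exact ⟨1, hone.symm ▸ hG, hone.symm ▸ htriv⟩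
  · push Not at htriv
    obtain ⟨h1, h2, u, hu, i, hi, hne⟩ := htriv
    have hu1 : (u : Matrix (Fin 3) (Fin 3) (ZMod p)) 1 0 ≠ 0 := by
      intro h0
      have hi2 : i = 2 := by
        have : i ≠ 1 := fun hi1 => hne (hi1 ▸ h0)
        omega
      subst hi2
      refine h2 ⟨u, hu, hne, fun j hj hj2 => ?_⟩
      have hj1 : j = 1 := by omega
      exact hj1 ▸ h0
    have hu2 : (u : Matrix (Fin 3) (Fin 3) (ZMod p)) 2 0 ≠ 0 := by
      intro h0
      refine h1 ⟨u, hu, hu1, fun j hj hj1 => ?_⟩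
      have hj2 : j = 2 := by omega
      exact hj2 ▸ h0
    set f := -(u : Matrix (Fin 3) (Fin 3) (ZMod p)) 2 0 / (u : Matrix (Fin 3) (Fin 3) (ZMod p)) 1 0
      with hf
    refine ⟨lowerUnitri 0 0 f, ?_, Or.inl ⟨_, ⟨⟨u, hu.1, rfl⟩, fun k => ?_⟩, ?_, ?_⟩⟩
    · rintro _ ⟨g, hg, rfl⟩
      exact isArrow_lowerUnitri_conj (hG g hg)
        (by rw [apply_self_eq_of_not_hasUnipRow hG h2 hu hu2 hg])
    · change (MulAut.conj (lowerUnitri 0 0 f) u).1 k k = 1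
      rw [coe_lowerUnitri_conj 0 0 f (hG u hu.1)]
      fin_cases k
      · exact hu.2 0
      · exact hu.2 1
      · exact hu.2 2
    · change (MulAut.conj (lowerUnitri 0 0 f) u).1 1 0 ≠ 0
      rw [coe_lowerUnitri_conj 0 0 f (hG u hu.1)]
      simpa using hu1
    · intro j hj hj1
      have hj2 : j = 2 := by omega
      subst hj2
      change (MulAut.conj (lowerUnitri 0 0 f) u).1 2 0 = 0
      rw [coe_lowerUnitri_conj 0 0 f (hG u hu.1)]
      simp [hf, div_mul_cancel₀ _ hu1]

theorem exists_conj_isArrow_transvection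
    (hG : ∀ g ∈ G, IsArrow (g : Matrix (Fin 3) (Fin 3) (ZMod p)))
    (h : ∀ i : Fin 3, i ≠ 0 → (∃ t, ∀ g ∈ G, (g : Matrix (Fin 3) (Fin 3) (ZMod p)) i 0 =
      t * ((g : Matrix (Fin 3) (Fin 3) (ZMod p)) i i -
        (g : Matrix (Fin 3) (Fin 3) (ZMod p)) 0 0)) ∨
      ∃ g ∈ G, (g : Matrix (Fin 3) (Fin 3) (ZMod p)) = Matrix.transvection i 0 1) :
    ∃ P : Matrix.SpecialLinearGroup (Fin 3) (ZMod p),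
      (∀ g ∈ G.map (MulAut.conj P).toMonoidHom,
        IsArrow (g : Matrix (Fin 3) (Fin 3) (ZMod p))) ∧
      ∀ i : Fin 3, i ≠ 0 →
        (∀ g ∈ G.map (MulAut.conj P).toMonoidHom,
          (g : Matrix (Fin 3) (Fin 3) (ZMod p)) i 0 = 0) ∨
        ∃ g ∈ G.map (MulAut.conj P).toMonoidHom,
          (g : Matrix (Fin 3) (Fin 3) (ZMod p)) = Matrix.transvection i 0 1 := by
  have key : ∀ c e : ZMod p, ∀ i : Fin 3, i ≠ 0 →
      (∀ g ∈ G, (g : Matrix (Fin 3) (Fin 3) (ZMod p)) i 0 =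
        ![0, c, e] i * ((g : Matrix (Fin 3) (Fin 3) (ZMod p)) i i -
          (g : Matrix (Fin 3) (Fin 3) (ZMod p)) 0 0)) →
      ∀ g ∈ G.map (MulAut.conj (lowerUnitri c e 0)).toMonoidHom,
          (g : Matrix (Fin 3) (Fin 3) (ZMod p)) i 0 = 0 := by
    rintro c e i hi hA _ ⟨g, hg, rfl⟩
    change (MulAut.conj (lowerUnitri c e 0) g).1 i 0 = 0
    rw [coe_lowerUnitri_conj c e 0 (hG g hg)]
    have h1 := hA g hg
    fin_cases i
    · exact absurd rfl hi
    · simp at h1 ⊢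
      linear_combination h1
    · simp at h1 ⊢
      linear_combination h1
  have key' : ∀ c e : ZMod p, ∀ i : Fin 3, i ≠ 0 →
      (∃ g ∈ G, (g : Matrix (Fin 3) (Fin 3) (ZMod p)) = Matrix.transvection i 0 1) →
      ∃ g ∈ G.map (MulAut.conj (lowerUnitri c e 0)).toMonoidHom,
          (g : Matrix (Fin 3) (Fin 3) (ZMod p)) = Matrix.transvection i 0 1 := by
    rintro c e i hi ⟨g, hg, hgi⟩
    refine ⟨_, ⟨g, hg, rfl⟩, ?_⟩
    change (MulAut.conj (lowerUnitri c e 0) g).1 = _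
    rw [coe_lowerUnitri_conj c e 0 (hG g hg), hgi]
    ext j k
    fin_cases i
    · exact absurd rfl hi
    all_goals fin_cases j <;> fin_cases k <;> simp [Matrix.transvection]
  have hex : ∀ i : Fin 3, i ≠ 0 → ∃ t, (∀ g ∈ G, (g : Matrix (Fin 3) (Fin 3) (ZMod p)) i 0 =
      t * ((g : Matrix (Fin 3) (Fin 3) (ZMod p)) i i -
        (g : Matrix (Fin 3) (Fin 3) (ZMod p)) 0 0)) ∨
      ∃ g ∈ G, (g : Matrix (Fin 3) (Fin 3) (ZMod p)) = Matrix.transvection i 0 1 := by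
    intro i hi
    rcases h i hi with ⟨t, ht⟩ | h
    · exact ⟨t, Or.inl ht⟩
    · exact ⟨0, Or.inr h⟩
  obtain ⟨c, hc⟩ := hex 1 (by decide)
  obtain ⟨e, he⟩ := hex 2 (by decide)
  refine ⟨lowerUnitri c e 0, ?_, fun i hi => ?_⟩
  · rintro _ ⟨g, hg, rfl⟩
    exact isArrow_lowerUnitri_conj (hG g hg) (by rw [zero_mul, zero_mul])
  · refine Or.imp (key c e i hi) (key' c e i hi) ?_
    fin_cases i
    · exact absurd rfl hi
    · exact hc
    · exact he

end ArrowNormalForm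

section CommonLine

/-- Two distinct planes in a three-dimensional space which are stable under `G` give a basis in
which `G` consists of arrow matrices. -/
theorem exists_conj_isArrow {F : Type u} [Field F]
    (G : Subgroup (Matrix.SpecialLinearGroup (Fin 3) F))
    (W₁ W₂ : Submodule F (Fin 3 → F)) (hne : W₁ ≠ W₂)
    (hW₁ : Module.finrank F W₁ = 2) (hW₂ : Module.finrank F W₂ = 2)
    (hG₁ : ∀ g ∈ G, ∀ x ∈ W₁, x ᵥ* (g : Matrix (Fin 3) (Fin 3) F) ∈ W₁)
    (hG₂ : ∀ g ∈ G, ∀ x ∈ W₂, x ᵥ* (g : Matrix (Fin 3) (Fin 3) F) ∈ W₂) :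
    ∃ P : Matrix.SpecialLinearGroup (Fin 3) F,
      ∀ g ∈ G.map (MulAut.conj P).toMonoidHom, IsArrow (g : Matrix (Fin 3) (Fin 3) F) := by
  obtain ⟨e₀, he₀, hne₀⟩ : ∃ x ∈ W₁ ⊓ W₂, x ≠ 0 := by
    refine Submodule.exists_mem_ne_zero_of_ne_bot fun hbot => ?_
    have h1 := Submodule.finrank_sup_add_finrank_inf_eq W₁ W₂
    have h2 := Submodule.finrank_le (W₁ ⊔ W₂)
    rw [hbot, finrank_bot, hW₁, hW₂] at h1
    rw [Module.finrank_fin_fun] at h2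
    omega
  obtain ⟨e₁, he₁, hne₁⟩ : ∃ x ∈ W₁, x ∉ W₂ := SetLike.not_le_iff_exists.1 fun hle =>
    hne (Submodule.eq_of_le_of_finrank_eq hle (hW₁.trans hW₂.symm))
  obtain ⟨e₂, he₂, hne₂⟩ : ∃ x ∈ W₂, x ∉ W₁ := SetLike.not_le_iff_exists.1 fun hle =>
    hne (Submodule.eq_of_le_of_finrank_eq hle (hW₂.trans hW₁.symm)).symm
  have hvec : ∀ (c : F) (v : Fin 3 → F), v ᵥ* Matrix.of ![c • e₀, e₁, e₂] =
      v 0 • c • e₀ + v 1 • e₁ + v 2 • e₂ := by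
    intro c v
    ext j
    simp [Matrix.vecMul, dotProduct, Fin.sum_univ_three]
  have hcoef₂ : ∀ (c : F) (v : Fin 3 → F), v ᵥ* Matrix.of ![c • e₀, e₁, e₂] ∈ W₁ → v 2 = 0 := by
    intro c v hv
    by_contra h2
    rw [hvec, Submodule.add_mem_iff_right _ (W₁.add_mem (W₁.smul_mem _ (W₁.smul_mem _ he₀.1))
      (W₁.smul_mem _ he₁)), W₁.smul_mem_iff h2] at hv
    exact hne₂ hv
  have hcoef₁ : ∀ (c : F) (v : Fin 3 → F), v ᵥ* Matrix.of ![c • e₀, e₁, e₂] ∈ W₂ → v 1 = 0 := by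
    intro c v hv
    by_contra h1
    rw [hvec, Submodule.add_mem_iff_left _ (W₂.smul_mem _ he₂), Submodule.add_mem_iff_right _
      (W₂.smul_mem _ (W₂.smul_mem _ he₀.2)), W₂.smul_mem_iff h1] at hv
    exact hne₁ hv
  have hdet : (Matrix.of ![(1 : F) • e₀, e₁, e₂]).det ≠ 0 := by
    intro h0
    obtain ⟨v, hv0, hv⟩ := Matrix.exists_vecMul_eq_zero_iff.2 h0
    have hv2 := hcoef₂ 1 v (hv ▸ W₁.zero_mem)
    have hv1 := hcoef₁ 1 v (hv ▸ W₂.zero_mem)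
    rw [hvec, hv1, hv2, zero_smul, zero_smul, add_zero, add_zero, one_smul,
      smul_eq_zero_iff_left hne₀] at hv
    refine hv0 (funext fun i => ?_)
    fin_cases i
    exacts [hv, hv1, hv2]
  have hdet₁ : ∃ c : F, (Matrix.of ![c • e₀, e₁, e₂]).det = 1 := by
    refine ⟨(Matrix.of ![(1 : F) • e₀, e₁, e₂]).det⁻¹, ?_⟩
    conv_rhs => rw [← inv_mul_cancel₀ hdet]
    generalize (Matrix.of ![(1 : F) • e₀, e₁, e₂]).det⁻¹ = c
    simp [Matrix.det_fin_three]
    ring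
  obtain ⟨c, hc⟩ := hdet₁
  refine ⟨⟨_, hc⟩, ?_⟩
  set P : Matrix.SpecialLinearGroup (Fin 3) F := ⟨_, hc⟩
  rintro _ ⟨g, hg, rfl⟩
  change IsArrow (MulAut.conj P g).1
  have hT : MulAut.conj P g * P = P * g := by simp [MulAut.conj_apply]
  generalize MulAut.conj P g = T at hT
  have hrow : ∀ i, T.1 i ᵥ* Matrix.of ![c • e₀, e₁, e₂] = P.1 i ᵥ* g.1 := fun i =>
    congrArg (fun M : Matrix.SpecialLinearGroup (Fin 3) F => M.1 i) hT
  refine ⟨hcoef₁ c _ ?_, hcoef₂ c _ ?_, hcoef₂ c _ ?_, hcoef₁ c _ ?_⟩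
  · exact hrow 0 ▸ hG₂ g hg _ (W₂.smul_mem c he₀.2)
  · exact hrow 0 ▸ hG₁ g hg _ (W₁.smul_mem c he₀.1)
  · exact hrow 1 ▸ hG₁ g hg _ he₁
  · exact hrow 2 ▸ hG₂ g hg _ he₂

end CommonLine

section Main

/-- The invariant ring of a group of arrow matrices in normal form is Gorenstein. -/
theorem isGorensteinRing_of_isArrow {p : ℕ} [Fact p.Prime]
    {G : Subgroup (Matrix.SpecialLinearGroup (Fin 3) (ZMod p))}
    (hG : ∀ g ∈ G, IsArrow (g : Matrix (Fin 3) (Fin 3) (ZMod p)))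
    (h : ∀ i : Fin 3, i ≠ 0 → (∀ g ∈ G, (g : Matrix (Fin 3) (Fin 3) (ZMod p)) i 0 = 0) ∨
      ∃ g ∈ G, (g : Matrix (Fin 3) (Fin 3) (ZMod p)) = Matrix.transvection i 0 1)
    {R : Type} [CommRing R] (e : invariantRing G ≃+* R) : IsGorensteinRing R := by
  obtain ⟨e'⟩ := nonempty_ringEquiv_diagonal
    {M | ∃ g ∈ G, (g : Matrix (Fin 3) (Fin 3) (ZMod p)) = M}
    (by rintro _ ⟨g, hg, rfl⟩ j hj; exact (hG g hg).apply_eq_zero hj hj)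
    (by rintro _ ⟨g, hg, rfl⟩; exact (hG g hg).apply_self_ne_zero 0)
    (by rintro i - _ ⟨g, hg, rfl⟩ j hj hji; exact (hG g hg).apply_eq_zero hj hji)
    (fun i hi => (h i hi).imp_left (by rintro h _ ⟨g, hg, rfl⟩; exact h g hg))
  refine isGorensteinRing_of_ringEquiv_diagonal
    (Nat.sub_pos_of_lt (Fact.out : p.Prime).one_lt) _ ?_ ?_ (RingEquiv.trans e' e)
  · rintro _ ⟨_, ⟨g, hg, rfl⟩, rfl⟩ i
    exact ZMod.pow_card_sub_one_eq_one ((hG g hg).apply_self_ne_zero i)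
  · rintro _ ⟨_, ⟨g, hg, rfl⟩, rfl⟩
    exact (hG g hg).det_eq.symm.trans g.det_coe

end Main

/-- If `G ⊆ SL(3, 𝔽_p)` and `V = 𝔽_p³` contains two distinct 2-dimensional
`G`-submodules, then `S(V)^G` is Gorenstein. -/
theorem stmt14 (p : ℕ) [Fact p.Prime]
    (G : Subgroup (Matrix.SpecialLinearGroup (Fin 3) (ZMod p)))
    (W₁ W₂ : Submodule (ZMod p) (Fin 3 → ZMod p)) (hne : W₁ ≠ W₂)
    (hW₁ : Module.finrank (ZMod p) W₁ = 2) (hW₂ : Module.finrank (ZMod p) W₂ = 2)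
    (hG₁ : ∀ g ∈ G, ∀ x ∈ W₁, x ᵥ* (g : Matrix (Fin 3) (Fin 3) (ZMod p)) ∈ W₁)
    (hG₂ : ∀ g ∈ G, ∀ x ∈ W₂, x ᵥ* (g : Matrix (Fin 3) (Fin 3) (ZMod p)) ∈ W₂) :
    IsGorensteinRing ↥(invariantRing G) := by
  obtain ⟨P, hP⟩ := exists_conj_isArrow G W₁ W₂ hne hW₁ hW₂ hG₁ hG₂
  obtain ⟨Q, hQ, hrow⟩ := exists_conj_hasUnipRow hP
  obtain ⟨R, hR, hrow'⟩ := exists_conj_isArrow_transvection hQ fun i hi =>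
    exists_coboundary_or_transvection hQ hrow hi
  obtain ⟨e₁⟩ := nonempty_ringEquiv_invariantRing_conj G P
  obtain ⟨e₂⟩ := nonempty_ringEquiv_invariantRing_conj (G.map (MulAut.conj P).toMonoidHom) Q
  obtain ⟨e₃⟩ := nonempty_ringEquiv_invariantRing_conj
    ((G.map (MulAut.conj P).toMonoidHom).map (MulAut.conj Q).toMonoidHom) R
  exact isGorensteinRing_of_isArrow hR hrow' (e₃.trans (e₂.trans e₁))

end
end

section
/- Let F be a field of characteristic p > 0, V a finite-dimensional F-vector space, and G ⊆ GL(V) a finite subgroup generated by transvections. Let W ⊆ V be a G-submodule with dim_F W = dim_F V − 1, and let Fix_G(W) = {g ∈ G : g(w) = w for all w ∈ W}. Then |Fix_G(W)| = p^t for some t ≥ 0, and for any fixed v ∈ V \ W there exist elements q₁, …, q_t ∈ S(W) that are invariant under the image of G in GL(W), with q_i homogeneous of degree p^t − p^{t−i}, such that, setting z = v^{p^t} + q₁ v^{p^{t−1}} + ⋯ + q_t v, one has S(V)^{Fix_G(W)} = S(W)[z], the F-subalgebra of S(V) generated by S(W) and z. -/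
noncomputable section
open CategoryTheory Matrix MvPolynomial

universe u

/-- The degree-one element of `S(V) = F[X 0, …, X (m-1)]` corresponding to a vector `v ∈ V`. -/
def linForm {F : Type u} [CommSemiring F] {m : ℕ} (v : Fin m → F) : MvPolynomial (Fin m) F :=
  ∑ i, MvPolynomial.C (v i) * MvPolynomial.X i

/-- If `n` is not a power of the prime `p`, some proper binomial coefficient of `n` is nonzero
modulo `p`. -/
theorem exists_not_dvd_choose (p : ℕ) [hp : Fact p.Prime] {n : ℕ} (hn : 0 < n)
    (h : ∀ k, n ≠ p ^ k) : ∃ k, 0 < k ∧ k < n ∧ ¬ p ∣ n.choose k := by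
  obtain ⟨a, b, hb, rfl⟩ := Nat.exists_eq_pow_mul_and_not_dvd hn.ne' p hp.out.ne_one
  have hpos : 0 < p ^ a := pow_pos hp.out.pos a
  have hb1 : 1 < b := by
    rcases b with _ | _ | b
    · simp at hb
    · exact absurd (by simp) (h a)
    · omega
  refine ⟨p ^ a, hpos, by nlinarith, ?_⟩
  have key : ∀ a, (p ^ a * b).choose (p ^ a) ≡ b [MOD p] := by
    intro a
    induction a with
    | zero => simp [Nat.ModEq.refl]
    | succ a ih =>
      refine (Choose.choose_modEq_choose_mod_mul_choose_div_nat (p := p)).trans ?_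
      have h1 : p ^ (a + 1) * b = p * (p ^ a * b) := by ring
      have h2 : p ^ (a + 1) = p * p ^ a := by ring
      rw [h1, h2, Nat.mul_mod_right, Nat.mul_mod_right, Nat.mul_div_cancel_left _ hp.out.pos,
        Nat.mul_div_cancel_left _ hp.out.pos]
      simpa using ih
  rwa [(key a).dvd_iff dvd_rfl]

section OrbitPoly

open Polynomial

variable {E R : Type*} [AddCommGroup E] [Fintype E] [CommRing R]

/-- The polynomial `∏ e, (X + j e)` attached to an additive map `j` from a finite group. -/
def orbitPoly (j : E →+ R) : R[X] := ∏ e, (Polynomial.X + Polynomial.C (j e))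

theorem orbitPoly_monic (j : E →+ R) : (orbitPoly j).Monic :=
  monic_prod_of_monic _ _ fun _ _ => monic_X_add_C _

theorem orbitPoly_natDegree [Nontrivial R] (j : E →+ R) :
    (orbitPoly j).natDegree = Fintype.card E := by
  rw [orbitPoly, natDegree_prod_of_monic _ _ fun _ _ => monic_X_add_C _]
  simp

theorem orbitPoly_comp (j : E →+ R) (a : E) :
    (orbitPoly j).comp (Polynomial.X + Polynomial.C (j a)) = orbitPoly j := by
  rw [orbitPoly, Polynomial.prod_comp]
  exact Fintype.prod_equiv (Equiv.addRight a) _ _ fun e => by simp; ring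

theorem orbitPoly_eval_add (j : E →+ R) (a : E) (y : R) :
    (orbitPoly j).eval (y + j a) = (orbitPoly j).eval y := by
  conv_rhs => rw [← orbitPoly_comp j a]
  simp

theorem orbitPoly_eval_zero (j : E →+ R) : (orbitPoly j).eval 0 = 0 := by
  rw [orbitPoly, Polynomial.eval_prod]
  exact Finset.prod_eq_zero (Finset.mem_univ 0) (by simp)

theorem orbitPoly_eval_apply (j : E →+ R) (a : E) : (orbitPoly j).eval (j a) = 0 := by
  simpa [orbitPoly_eval_zero] using orbitPoly_eval_add j a 0

theorem orbitPoly_map {S : Type*} [CommRing S] (f : R →+* S) (j : E →+ R) :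
    (orbitPoly j).map f = orbitPoly (f.toAddMonoidHom.comp j) := by
  simp [orbitPoly, Polynomial.map_prod]

theorem orbitPoly_comp_X_add_C [IsDomain R] (j : E →+ R) (hj : Function.Injective j) (y : R) :
    (orbitPoly j).comp (Polynomial.X + Polynomial.C y) =
      orbitPoly j + Polynomial.C ((orbitPoly j).eval y) := by
  have hm := (orbitPoly_monic j).comp_X_add_C y
  have hd : ((orbitPoly j).comp (Polynomial.X + Polynomial.C y)).natDegree = Fintype.card E := by
    rw [natDegree_comp, orbitPoly_natDegree]; simp
  rw [← sub_eq_zero, ← sub_sub]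
  refine eq_zero_of_natDegree_lt_card_of_eval_eq_zero _ hj (fun e => ?_) ?_
  · have : (orbitPoly j).eval (j e + y) = (orbitPoly j).eval y := by
      rw [add_comm, orbitPoly_eval_add]
    simp [orbitPoly_eval_apply, this]
  · rw [natDegree_sub_C]
    have h1 := degree_sub_lt_left (p := (orbitPoly j).comp (Polynomial.X + Polynomial.C y))
      (q := orbitPoly j) ((degree_eq_iff_natDegree_eq_of_pos Fintype.card_pos).2 hd |>.trans
        ((degree_eq_iff_natDegree_eq_of_pos Fintype.card_pos).2 (orbitPoly_natDegree j)).symm)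
      hm.ne_zero (by rw [hm, orbitPoly_monic j])
    by_cases h0 : (orbitPoly j).comp (Polynomial.X + Polynomial.C y) - orbitPoly j = 0
    · rw [h0]; simpa using Fintype.card_pos
    · rw [← hd]; exact natDegree_lt_natDegree h0 h1

/-- An orbit polynomial in characteristic `p` is a `p`-polynomial. -/
theorem orbitPoly_coeff_eq_zero (p : ℕ) [Fact p.Prime] [IsDomain R] [CharP R p] (j : E →+ R)
    (hj : Function.Injective j) {n : ℕ} (hn : ∀ k, n ≠ p ^ k) : (orbitPoly j).coeff n = 0 := by
  rcases Nat.eq_zero_or_pos n with rfl | hpos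
  · rw [coeff_zero_eq_eval_zero, orbitPoly_eval_zero]
  obtain ⟨k, hk0, hkn, hk⟩ := exists_not_dvd_choose p hpos hn
  have h := orbitPoly_comp_X_add_C ((Polynomial.C : R →+* R[X]).toAddMonoidHom.comp j)
    (Polynomial.C_injective.comp hj) Polynomial.X
  rw [← orbitPoly_map] at h
  have h2 := congrArg (fun Q => Q.coeff k) h
  simp only [← taylor_apply, taylor_coeff, Polynomial.coeff_add, Polynomial.coeff_map,
    Polynomial.coeff_C, hk0.ne', if_false, add_zero] at h2
  have h3 : hasseDeriv k (orbitPoly j) = Polynomial.C ((orbitPoly j).coeff k) := by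
    rw [← h2]
    have : hasseDeriv k ((orbitPoly j).map Polynomial.C) =
        (hasseDeriv k (orbitPoly j)).map (Polynomial.C : R →+* R[X]) := by
      ext1 n; simp [hasseDeriv_coeff]
    rw [this, Polynomial.eval_map, eval₂_C_X]
  have h4 := congrArg (fun Q => Q.coeff (n - k)) h3
  simp only [hasseDeriv_coeff, Polynomial.coeff_C, Nat.sub_add_cancel hkn.le,
    (Nat.sub_pos_of_lt hkn).ne', if_false] at h4
  refine (mul_eq_zero.1 h4).resolve_left fun h5 => hk ((CharP.cast_eq_zero_iff R p _).1 h5)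

theorem orbitPoly_eq_sum (p t : ℕ) [Fact p.Prime] [IsDomain R] [CharP R p] (j : E →+ R)
    (hj : Function.Injective j) (ht : Fintype.card E = p ^ t) :
    orbitPoly j = Polynomial.X ^ p ^ t + ∑ i : Fin t,
      Polynomial.C ((orbitPoly j).coeff (p ^ (t - 1 - (i : ℕ)))) *
        Polynomial.X ^ p ^ (t - 1 - (i : ℕ)) := by
  have hp := (Fact.out : p.Prime)
  have hlead : (orbitPoly j).coeff (p ^ t) = 1 := by
    rw [← ht, ← orbitPoly_natDegree j]; exact orbitPoly_monic j
  rw [Fin.sum_univ_eq_sum_range (fun i => Polynomial.C ((orbitPoly j).coeff (p ^ (t - 1 - i))) *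
        Polynomial.X ^ p ^ (t - 1 - i)), Finset.sum_range_reflect (fun i =>
        Polynomial.C ((orbitPoly j).coeff (p ^ i)) * Polynomial.X ^ p ^ i)]
  ext n
  simp only [Polynomial.coeff_add, Polynomial.coeff_X_pow, finsetSum_coeff,
    Polynomial.coeff_C_mul, mul_ite, mul_one, mul_zero]
  by_cases hn : ∃ k, n = p ^ k
  · obtain ⟨k, rfl⟩ := hn
    simp only [(Nat.pow_right_injective hp.two_le).eq_iff, Finset.sum_ite_eq, Finset.mem_range]
    rcases lt_trichotomy k t with h | rfl | h
    · simp [h, h.ne]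
    · simp [hlead]
    · rw [coeff_eq_zero_of_natDegree_lt]
      · simp [h.ne', h.not_gt]
      · rw [orbitPoly_natDegree, ht]; exact Nat.pow_lt_pow_right hp.one_lt h
  · push Not at hn
    rw [orbitPoly_coeff_eq_zero p j hj hn]
    simp [hn]

/-- A polynomial over a domain invariant under the translations by `j e` is a polynomial in the
orbit polynomial of `j`. -/
theorem exists_comp_orbitPoly [IsDomain R] (j : E →+ R) (hj : Function.Injective j) (f : R[X])
    (hf : ∀ e, f.comp (Polynomial.X + Polynomial.C (j e)) = f) :
    ∃ Q : R[X], f = Q.comp (orbitPoly j) := by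
  induction hd : f.natDegree using Nat.strong_induction_on generalizing f with
  | _ d ih =>
  subst hd
  have hm := orbitPoly_monic j
  have hcard : 0 < Fintype.card E := Fintype.card_pos
  have hinv : ∀ e, (f /ₘ orbitPoly j).comp (Polynomial.X + Polynomial.C (j e)) =
      f /ₘ orbitPoly j ∧ (f %ₘ orbitPoly j).comp (Polynomial.X + Polynomial.C (j e)) =
      f %ₘ orbitPoly j := by
    intro e
    have := div_modByMonic_unique (f := f)
      ((f /ₘ orbitPoly j).comp (Polynomial.X + Polynomial.C (j e)))
      ((f %ₘ orbitPoly j).comp (Polynomial.X + Polynomial.C (j e))) hm ⟨?_, ?_⟩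
    · exact ⟨this.1.symm, this.2.symm⟩
    · conv_rhs => rw [← hf e, ← modByMonic_add_div f (orbitPoly j)]
      rw [add_comp, mul_comp, orbitPoly_comp]
    · have : ((f %ₘ orbitPoly j).comp (Polynomial.X + Polynomial.C (j e))).degree =
          (f %ₘ orbitPoly j).degree := by
        rw [← taylor_apply, degree_taylor]
      rw [this]
      exact degree_modByMonic_lt _ hm
  have hr : f %ₘ orbitPoly j = Polynomial.C ((f %ₘ orbitPoly j).eval 0) := by
    rw [← sub_eq_zero]
    refine eq_zero_of_natDegree_lt_card_of_eval_eq_zero _ hj (fun e => ?_) ?_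
    · have := congrArg (Polynomial.eval 0) (hinv e).2
      simp only [eval_comp, Polynomial.eval_add, Polynomial.eval_X, Polynomial.eval_C,
        zero_add] at this
      simp [this]
    · rw [natDegree_sub_C, ← orbitPoly_natDegree j]
      refine natDegree_modByMonic_lt _ hm fun h1 => ?_
      have := orbitPoly_natDegree j
      rw [h1] at this
      simp at this
      omega
  by_cases hlt : f.natDegree < Fintype.card E
  · refine ⟨Polynomial.C ((f %ₘ orbitPoly j).eval 0), ?_⟩
    rw [C_comp, ← hr, (modByMonic_eq_self_iff hm).2]
    rw [← orbitPoly_natDegree j] at hlt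
    exact degree_lt_degree hlt
  · obtain ⟨Q, hQ⟩ := ih (f /ₘ orbitPoly j).natDegree
      (by rw [natDegree_divByMonic f hm, orbitPoly_natDegree]; omega) _
      (fun e => (hinv e).1) rfl
    refine ⟨Polynomial.C ((f %ₘ orbitPoly j).eval 0) + Polynomial.X * Q, ?_⟩
    rw [add_comp, mul_comp, ← hQ, C_comp, X_comp, ← hr, modByMonic_add_div]

end OrbitPoly

section LinForm

variable {F : Type u} {m : ℕ}

/-- `linForm` as a linear map. -/
def linFormHom (F : Type u) [CommSemiring F] (m : ℕ) :
    (Fin m → F) →ₗ[F] MvPolynomial (Fin m) F where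
  toFun := linForm
  map_add' x y := by simp [linForm, add_mul, Finset.sum_add_distrib]
  map_smul' a x := by simp [linForm, MvPolynomial.smul_eq_C_mul, Finset.mul_sum, mul_assoc]

@[simp]
theorem linFormHom_apply [CommSemiring F] (x : Fin m → F) : linFormHom F m x = linForm x := rfl

theorem linForm_single [CommSemiring F] (i : Fin m) :
    linForm (Pi.single i (1 : F)) = MvPolynomial.X i := by
  rw [linForm, Finset.sum_eq_single i] <;> simp +contextual

theorem linForm_injective [CommRing F] :
    Function.Injective (linForm : (Fin m → F) → MvPolynomial (Fin m) F) := by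
  intro x y h
  ext i
  have h2 := congrArg (fun f => MvPolynomial.aeval (Pi.single i (1 : F)) f) h
  simpa [linForm, Pi.single_apply] using h2

theorem linForm_isHomogeneous [CommSemiring F] (x : Fin m → F) :
    (linForm x).IsHomogeneous 1 :=
  IsHomogeneous.sum _ _ _ fun i _ => by
    simpa using (isHomogeneous_C _ (x i)).mul (isHomogeneous_X F i)

theorem aeval_linForm {S : Type*} [CommSemiring F] [CommSemiring S] [Algebra F S]
    (f : (Fin m → F) →ₗ[F] S) (x : Fin m → F) :
    MvPolynomial.aeval (fun i => f (Pi.single i 1)) (linForm x) = f x := by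
  have : (MvPolynomial.aeval (fun i => f (Pi.single i 1))).toLinearMap ∘ₗ linFormHom F m = f := by
    refine LinearMap.pi_ext' fun i => LinearMap.ext_ring ?_
    simp [linForm_single]
  exact LinearMap.congr_fun this x

theorem polyAct_linForm [CommRing F] (M : Matrix (Fin m) (Fin m) F) (x : Fin m → F) :
    polyAct M (linForm x) = linForm (x ᵥ* M) := by
  have h := aeval_linForm (linFormHom F m ∘ₗ M.vecMulLinear) x
  rw [LinearMap.comp_apply, Matrix.vecMulLinear_apply, linFormHom_apply] at h
  rw [← h, polyAct]
  congr 1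
  congr 1
  ext1 i
  simp [linForm, MvPolynomial.smul_eq_C_mul]

end LinForm

section Codim

variable {F : Type u} [Field F] {m : ℕ}

theorem exists_linearMap_sub_smul_mem {W : Submodule F (Fin m → F)}
    (hdimW : Module.finrank F W + 1 = m) {v : Fin m → F} (hv : v ∉ W) :
    ∃ l : (Fin m → F) →ₗ[F] F, l v = 1 ∧ ∀ x, x - l x • v ∈ W := by
  obtain ⟨f, hf, hW⟩ := Submodule.exists_le_ker_of_notMem hv
  have hrange : 0 < Module.finrank F (LinearMap.range f) := by
    rw [Module.finrank_pos_iff_exists_ne_zero]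
    exact ⟨⟨f v, v, rfl⟩, fun h => hf (congrArg Subtype.val h)⟩
  have hker : W = LinearMap.ker f := by
    refine Submodule.eq_of_le_of_finrank_le hW ?_
    have := f.finrank_range_add_finrank_ker
    rw [Module.finrank_fin_fun] at this
    omega
  refine ⟨(f v)⁻¹ • f, by simp [hf], fun x => ?_⟩
  rw [hker, LinearMap.mem_ker]
  simp
  field_simp
  simp

theorem vecMul_sub_mem_of_isTransvectionMat {W : Submodule F (Fin m → F)}
    (hdimW : Module.finrank F W + 1 = m) {M : Matrix (Fin m) (Fin m) F}
    (hM : IsTransvectionMat M) (hWM : ∀ x ∈ W, x ᵥ* M ∈ W) (x : Fin m → F) :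
    x ᵥ* M - x ∈ W := by
  have hN : ∀ y, y ᵥ* M - y = y ᵥ* (M - 1) := fun y => by simp [Matrix.vecMul_sub]
  have hWN : ∀ y ∈ W, y ᵥ* (M - 1) ∈ W := fun y hy => by
    rw [← hN]; exact W.sub_mem (hWM y hy) hy
  rw [hN]
  by_contra hx
  have hxW : x ∉ W := fun h => hx (hWN x h)
  obtain ⟨l, hl, hlW⟩ := exists_linearMap_sub_smul_mem hdimW hxW
  have h1 := hWN _ (hlW (x ᵥ* (M - 1)))
  rw [Matrix.sub_vecMul, Matrix.vecMul_vecMul, hM.2, Matrix.vecMul_zero, Matrix.smul_vecMul,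
    zero_sub, W.neg_mem_iff] at h1
  by_cases hc : l (x ᵥ* (M - 1)) = 0
  · have := hlW (x ᵥ* (M - 1))
    rw [hc, zero_smul, sub_zero] at this
    exact hx this
  · exact hx ((W.smul_mem_iff hc).1 h1)

theorem vecMul_inv_vecMul (g : (Matrix (Fin m) (Fin m) F)ˣ) (x : Fin m → F) :
    (x ᵥ* (↑g⁻¹ : Matrix (Fin m) (Fin m) F)) ᵥ* (↑g : Matrix (Fin m) (Fin m) F) = x := by
  rw [Matrix.vecMul_vecMul, Units.inv_mul, Matrix.vecMul_one]

theorem vecMul_vecMul_inv (g : (Matrix (Fin m) (Fin m) F)ˣ) (x : Fin m → F) :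
    (x ᵥ* (↑g : Matrix (Fin m) (Fin m) F)) ᵥ* (↑g⁻¹ : Matrix (Fin m) (Fin m) F) = x := by
  rw [Matrix.vecMul_vecMul, Units.mul_inv, Matrix.vecMul_one]

/-- A group generated by transvections acts trivially modulo an invariant hyperplane. -/
theorem vecMul_sub_mem {G : Subgroup (Matrix (Fin m) (Fin m) F)ˣ}
    (hgen : Subgroup.closure {g : (Matrix (Fin m) (Fin m) F)ˣ |
      g ∈ G ∧ IsTransvectionMat (↑g : Matrix (Fin m) (Fin m) F)} = G)
    {W : Submodule F (Fin m → F)} (hdimW : Module.finrank F W + 1 = m)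
    (hWG : ∀ g ∈ G, ∀ x ∈ W, x ᵥ* (↑g : Matrix (Fin m) (Fin m) F) ∈ W)
    {g : (Matrix (Fin m) (Fin m) F)ˣ} (hg : g ∈ G) (x : Fin m → F) :
    x ᵥ* (↑g : Matrix (Fin m) (Fin m) F) - x ∈ W := by
  rw [← hgen] at hg
  induction hg using Subgroup.closure_induction generalizing x with
  | mem g hg => exact vecMul_sub_mem_of_isTransvectionMat hdimW hg.2 (hWG g hg.1) x
  | one => simp
  | mul g h _ _ ihg ihh =>
    have := W.add_mem (ihh (x ᵥ* (↑g : Matrix (Fin m) (Fin m) F))) (ihg x)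
    rwa [sub_add_sub_cancel, Matrix.vecMul_vecMul, ← Units.val_mul] at this
  | inv g _ ih =>
    have := ih (x ᵥ* (↑g⁻¹ : Matrix (Fin m) (Fin m) F))
    rw [vecMul_inv_vecMul] at this
    rwa [← W.neg_mem_iff, neg_sub]

/-- The additive group of all `w ∈ W` such that some element of `G` fixing `W` pointwise maps
`v` to `v + w`. -/
def displacements (G : Subgroup (Matrix (Fin m) (Fin m) F)ˣ) (W : Submodule F (Fin m → F))
    (v : Fin m → F) : AddSubgroup (Fin m → F) where
  carrier := {w | w ∈ W ∧ ∃ g ∈ G, (∀ x ∈ W, x ᵥ* (↑g : Matrix (Fin m) (Fin m) F) = x) ∧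
    v ᵥ* (↑g : Matrix (Fin m) (Fin m) F) = v + w}
  zero_mem' := ⟨W.zero_mem, 1, G.one_mem, by simp, by simp⟩
  add_mem' := by
    rintro a b ⟨ha, g, hg, hgW, hgv⟩ ⟨hb, h, hh, hhW, hhv⟩
    refine ⟨W.add_mem ha hb, g * h, G.mul_mem hg hh, fun x hx => ?_, ?_⟩
    · rw [Units.val_mul, ← Matrix.vecMul_vecMul, hgW x hx, hhW x hx]
    · rw [Units.val_mul, ← Matrix.vecMul_vecMul, hgv, Matrix.add_vecMul, hhv, hhW a ha]
      abel
  neg_mem' := by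
    rintro a ⟨ha, g, hg, hgW, hgv⟩
    have hinv : ∀ x ∈ W, x ᵥ* (↑g⁻¹ : Matrix (Fin m) (Fin m) F) = x := fun x hx => by
      conv_lhs => rw [← hgW x hx]
      exact vecMul_vecMul_inv g x
    refine ⟨W.neg_mem ha, g⁻¹, G.inv_mem hg, hinv, ?_⟩
    have := vecMul_vecMul_inv g v
    rw [hgv, Matrix.add_vecMul, hinv a ha] at this
    rw [← sub_eq_add_neg, eq_sub_iff_add_eq, this]

theorem mem_displacements {G : Subgroup (Matrix (Fin m) (Fin m) F)ˣ}
    {W : Submodule F (Fin m → F)} {v w : Fin m → F} :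
    w ∈ displacements G W v ↔ w ∈ W ∧ ∃ g ∈ G,
      (∀ x ∈ W, x ᵥ* (↑g : Matrix (Fin m) (Fin m) F) = x) ∧
        v ᵥ* (↑g : Matrix (Fin m) (Fin m) F) = v + w := Iff.rfl

theorem exists_equiv_displacements {G : Subgroup (Matrix (Fin m) (Fin m) F)ˣ}
    {W : Submodule F (Fin m → F)} (hdimW : Module.finrank F W + 1 = m)
    (hGW : ∀ g ∈ G, ∀ x, x ᵥ* (↑g : Matrix (Fin m) (Fin m) F) - x ∈ W)
    {v : Fin m → F} (hv : v ∉ W) :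
    Nonempty ({g : (Matrix (Fin m) (Fin m) F)ˣ |
        g ∈ G ∧ ∀ x ∈ W, x ᵥ* (↑g : Matrix (Fin m) (Fin m) F) = x} ≃ displacements G W v) := by
  refine ⟨Equiv.ofBijective (fun g => ⟨v ᵥ* (↑g.1 : Matrix (Fin m) (Fin m) F) - v,
    hGW _ g.2.1 v, g.1, g.2.1, g.2.2, by abel⟩) ⟨?_, ?_⟩⟩
  · rintro ⟨g, hg, hgW⟩ ⟨h, hh, hhW⟩ heq
    have hvv : v ᵥ* (↑g : Matrix (Fin m) (Fin m) F) = v ᵥ* (↑h : Matrix (Fin m) (Fin m) F) :=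
      sub_left_injective (congrArg Subtype.val heq)
    obtain ⟨l, -, hl⟩ := exists_linearMap_sub_smul_mem hdimW hv
    refine Subtype.ext (Units.ext (Matrix.ext_iff_vecMul.2 fun x => ?_))
    have := (hgW _ (hl x)).trans (hhW _ (hl x)).symm
    rw [Matrix.sub_vecMul, Matrix.sub_vecMul, Matrix.smul_vecMul, Matrix.smul_vecMul, hvv] at this
    exact sub_left_injective this
  · rintro ⟨w, hw, g, hg, hgW, hgv⟩
    exact ⟨⟨g, hg, hgW⟩, Subtype.ext (by simp [hgv])⟩

theorem vecMul_mem_displacements {G : Subgroup (Matrix (Fin m) (Fin m) F)ˣ}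
    {W : Submodule F (Fin m → F)}
    (hGW : ∀ g ∈ G, ∀ x, x ᵥ* (↑g : Matrix (Fin m) (Fin m) F) - x ∈ W)
    (hWG : ∀ g ∈ G, ∀ x ∈ W, x ᵥ* (↑g : Matrix (Fin m) (Fin m) F) ∈ W)
    {v w : Fin m → F} (hw : w ∈ displacements G W v) {g : (Matrix (Fin m) (Fin m) F)ˣ}
    (hg : g ∈ G) : w ᵥ* (↑g : Matrix (Fin m) (Fin m) F) ∈ displacements G W v := by
  obtain ⟨hwW, h, hh, hhW, hhv⟩ := hw
  refine ⟨hWG g hg w hwW, g⁻¹ * h * g, G.mul_mem (G.mul_mem (G.inv_mem hg) hh) hg,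
    fun x hx => ?_, ?_⟩ <;>
  rw [Units.val_mul, Units.val_mul, ← Matrix.vecMul_vecMul, ← Matrix.vecMul_vecMul]
  · rw [hhW _ (hWG _ (G.inv_mem hg) x hx), vecMul_inv_vecMul]
  · have h1 := hhW _ (hGW _ (G.inv_mem hg) v)
    rw [Matrix.sub_vecMul, sub_eq_iff_eq_add, hhv] at h1
    rw [h1, ← add_assoc, sub_add_cancel, Matrix.add_vecMul, vecMul_inv_vecMul]

theorem exists_card_eq_pow (p : ℕ) [Fact p.Prime] [CharP F p]
    (U : AddSubgroup (Fin m → F)) [Finite U] : ∃ t, Nat.card U = p ^ t := by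
  let _ : Module (ZMod p) U := AddCommGroup.zmodModule fun x => by
    ext i
    simp
  exact ⟨_, by
    rw [Module.natCard_eq_pow_finrank (K := ZMod p) (V := U), Nat.card_zmod]⟩

end Codim

section SymmetricSubalgebra

variable {F : Type u} [Field F] {m : ℕ}

/-- The subalgebra `S(W)` of `S(V)`. -/
abbrev symSubalgebra (W : Submodule F (Fin m → F)) : Subalgebra F (MvPolynomial (Fin m) F) :=
  Algebra.adjoin F (linForm '' (W : Set (Fin m → F)))

/-- The canonical map `W → S(W)`. -/
def toSymSubalgebra (W : Submodule F (Fin m → F)) : W →ₗ[F] symSubalgebra W :=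
  ((linFormHom F m).domRestrict W).codRestrict (Subalgebra.toSubmodule (symSubalgebra W))
    fun x => Algebra.subset_adjoin ⟨x, x.2, rfl⟩

@[simp]
theorem coe_toSymSubalgebra (W : Submodule F (Fin m → F)) (w : W) :
    (toSymSubalgebra W w : MvPolynomial (Fin m) F) = linForm w.1 := rfl

theorem aeval_linForm_bijective {W : Submodule F (Fin m → F)}
    (hdimW : Module.finrank F W + 1 = m) {v : Fin m → F} (hv : v ∉ W) :
    Function.Bijective (Polynomial.aeval (R := symSubalgebra W) (linForm v)) := by
  obtain ⟨l, hlv, hl⟩ := exists_linearMap_sub_smul_mem hdimW hv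
  have hlW : ∀ w ∈ W, l w = 0 := fun w hw => by
    by_contra h
    exact hv ((W.smul_mem_iff h).1 ((W.sub_mem_iff_right hw).1 (hl w)))
  let π : (Fin m → F) →ₗ[F] W := (LinearMap.id - l.smulRight v).codRestrict W fun x => hl x
  let Λ : (Fin m → F) →ₗ[F] Polynomial (symSubalgebra W) :=
    (Polynomial.CAlgHom (R := F)).toLinearMap ∘ₗ toSymSubalgebra W ∘ₗ π +
      l.smulRight Polynomial.X
  have hΛ : ∀ x, Λ x = Polynomial.C (toSymSubalgebra W (π x)) + l x • Polynomial.X := fun _ => rfl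
  have hπ : ∀ x, (π x : Fin m → F) = x - l x • v := fun _ => rfl
  let φ : Polynomial (symSubalgebra W) →ₐ[F] MvPolynomial (Fin m) F :=
    (Polynomial.aeval (R := symSubalgebra W) (linForm v)).restrictScalars F
  let ψ : MvPolynomial (Fin m) F →ₐ[F] Polynomial (symSubalgebra W) :=
    MvPolynomial.aeval fun i => Λ (Pi.single i 1)
  have hψ : ∀ x, ψ (linForm x) = Λ x := aeval_linForm Λ
  have hφ : ∀ x, φ (Λ x) = linForm x := fun x => by
    have h1 : linForm (x - l x • v) = linForm x - l x • linForm v := by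
      simp only [← linFormHom_apply, map_sub, map_smul]
    rw [hΛ, map_add, map_smul]
    simp only [φ, AlgHom.restrictScalars_apply, Polynomial.aeval_C, Polynomial.aeval_X]
    rw [Subalgebra.algebraMap_def, coe_toSymSubalgebra, hπ, h1]
    exact sub_add_cancel _ _
  have hφψ : φ.comp ψ = AlgHom.id F _ := by
    refine MvPolynomial.algHom_ext fun i => ?_
    rw [AlgHom.comp_apply, ← linForm_single, hψ, hφ, AlgHom.id_apply]
  have hC : ψ.comp (symSubalgebra W).val = Polynomial.CAlgHom := by
    refine AlgHom.adjoin_ext ?_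
    rintro _ ⟨w, hw, rfl⟩
    rw [AlgHom.comp_apply, Subalgebra.val_apply, hψ, hΛ, hlW w hw, zero_smul, add_zero]
    rw [Polynomial.CAlgHom_apply]
    congr 1
    ext1
    rw [coe_toSymSubalgebra, hπ, hlW w hw, zero_smul, sub_zero]
  have hψφ : ∀ P, ψ (φ P) = P := by
    intro P
    induction P using Polynomial.induction_on' with
    | add p q hp hq => rw [map_add, map_add, hp, hq]
    | monomial n a =>
      have h1 : φ (Polynomial.monomial n a) = a.1 * linForm v ^ n := by
        simp [φ, Polynomial.aeval_monomial]
      have h2 : ψ a.1 = Polynomial.C a := DFunLike.congr_fun hC a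
      have h3 : Λ v = Polynomial.X := by
        rw [hΛ, hlv, one_smul, show π v = 0 from Subtype.ext (by simp [hπ, hlv])]
        simp
      rw [h1, map_mul, map_pow, h2, hψ, h3, Polynomial.C_mul_X_pow_eq_monomial]
  exact ⟨Function.LeftInverse.injective (g := ψ) hψφ,
    fun f => ⟨ψ f, DFunLike.congr_fun hφψ f⟩⟩

theorem polyAct_eq_self_of_mem {W : Submodule F (Fin m → F)} {M : Matrix (Fin m) (Fin m) F}
    (hM : ∀ x ∈ W, x ᵥ* M = x) {a : MvPolynomial (Fin m) F} (ha : a ∈ symSubalgebra W) :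
    polyAct M a = a := by
  have : symSubalgebra W ≤ AlgHom.equalizer (polyAct M) (AlgHom.id F _) := by
    refine Algebra.adjoin_le ?_
    rintro _ ⟨x, hx, rfl⟩
    simp [polyAct_linForm, hM x hx]
  exact this ha

theorem polyAct_aeval {W : Submodule F (Fin m → F)} {M : Matrix (Fin m) (Fin m) F}
    (hM : ∀ x ∈ W, x ᵥ* M = x) (b : MvPolynomial (Fin m) F)
    (P : Polynomial (symSubalgebra W)) :
    polyAct M (Polynomial.aeval b P) = Polynomial.aeval (polyAct M b) P := by
  rw [Polynomial.aeval_eq_sum_range, Polynomial.aeval_eq_sum_range, map_sum]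
  refine Finset.sum_congr rfl fun i _ => ?_
  rw [Subalgebra.smul_def, Subalgebra.smul_def, smul_eq_mul, smul_eq_mul, map_mul, map_pow,
    polyAct_eq_self_of_mem hM (P.coeff i).2]

end SymmetricSubalgebra

section Invariants

variable {F : Type u} [Field F] {m : ℕ}

/-- The canonical map from the displacement group to `S(W)`. -/
def displacementsToSym (G : Subgroup (Matrix (Fin m) (Fin m) F)ˣ) (W : Submodule F (Fin m → F))
    (v : Fin m → F) : displacements G W v →+ symSubalgebra W :=
  (toSymSubalgebra W).toAddMonoidHom.comp
    (AddSubgroup.inclusion (K := W.toAddSubgroup) fun _ hw => (mem_displacements.1 hw).1)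

@[simp]
theorem coe_displacementsToSym {G : Subgroup (Matrix (Fin m) (Fin m) F)ˣ}
    {W : Submodule F (Fin m → F)} {v : Fin m → F} (w : displacements G W v) :
    (displacementsToSym G W v w : MvPolynomial (Fin m) F) = linForm w.1 := rfl

theorem displacementsToSym_injective (G : Subgroup (Matrix (Fin m) (Fin m) F)ˣ)
    (W : Submodule F (Fin m → F)) (v : Fin m → F) :
    Function.Injective (displacementsToSym G W v) := fun _ _ h =>
  Subtype.ext (linForm_injective (congrArg Subtype.val h))

variable {G : Subgroup (Matrix (Fin m) (Fin m) F)ˣ} {W : Submodule F (Fin m → F)}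
  {v : Fin m → F}

theorem aeval_add_linForm (w : displacements G W v)
    (P : Polynomial (symSubalgebra W)) :
    Polynomial.aeval (linForm (v + w.1)) P = Polynomial.aeval (linForm v)
      (P.comp (Polynomial.X + Polynomial.C (displacementsToSym G W v w))) := by
  rw [Polynomial.aeval_comp]
  congr 2
  rw [map_add, Polynomial.aeval_X, Polynomial.aeval_C]
  exact (linFormHom F m).map_add v w.1

variable [Fintype (displacements G W v)]

theorem orbitPoly_coeff_isHomogeneous {k : ℕ} (hk : k ≤ Fintype.card (displacements G W v)) :
    ((orbitPoly (displacementsToSym G W v)).coeff k : MvPolynomial (Fin m) F).IsHomogeneous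
      (Fintype.card (displacements G W v) - k) := by
  rw [orbitPoly, Finset.prod_X_add_C_coeff _ _ (by simpa using hk)]
  push_cast
  refine IsHomogeneous.sum _ _ _ fun s hs => ?_
  have h := IsHomogeneous.prod s (fun w => linForm w.1) (fun _ => 1)
    fun w _ => linForm_isHomogeneous w.1
  rwa [Finset.sum_const, smul_eq_mul, mul_one, (Finset.mem_powersetCard.1 hs).2] at h

theorem polyAct_orbitPoly_coeff
    (hGW : ∀ g ∈ G, ∀ x, x ᵥ* (↑g : Matrix (Fin m) (Fin m) F) - x ∈ W)
    (hWG : ∀ g ∈ G, ∀ x ∈ W, x ᵥ* (↑g : Matrix (Fin m) (Fin m) F) ∈ W)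
    {g : (Matrix (Fin m) (Fin m) F)ˣ} (hg : g ∈ G) (k : ℕ) :
    polyAct (↑g : Matrix (Fin m) (Fin m) F) ((orbitPoly (displacementsToSym G W v)).coeff k) =
      (orbitPoly (displacementsToSym G W v)).coeff k := by
  let σ : displacements G W v → displacements G W v := fun w =>
    ⟨w.1 ᵥ* (↑g : Matrix (Fin m) (Fin m) F), vecMul_mem_displacements hGW hWG w.2 hg⟩
  have hσ : Function.Bijective σ := Finite.injective_iff_bijective.1 fun a b hab => by
    have := congrArg (fun w => w.1 ᵥ* (↑g⁻¹ : Matrix (Fin m) (Fin m) F)) hab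
    simp only [σ, vecMul_vecMul_inv] at this
    exact Subtype.ext this
  have h1 : (orbitPoly (displacementsToSym G W v)).map (symSubalgebra W).val.toRingHom =
      ∏ w : displacements G W v, (Polynomial.X + Polynomial.C (linForm w.1)) := by
    simp [orbitPoly, Polynomial.map_prod]
  have h2 : (∏ w : displacements G W v, (Polynomial.X + Polynomial.C (linForm w.1))).map
      (polyAct (↑g : Matrix (Fin m) (Fin m) F)).toRingHom =
      ∏ w : displacements G W v, (Polynomial.X + Polynomial.C (linForm w.1)) := by
    simp only [Polynomial.map_prod, Polynomial.map_add, Polynomial.map_X, Polynomial.map_C]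
    refine Eq.trans (Finset.prod_congr rfl fun w _ => ?_)
      (hσ.prod_comp fun w => Polynomial.X + Polynomial.C (linForm w.1))
    simp [polyAct_linForm, σ]
  rw [← h1] at h2
  simpa using congrArg (fun P => P.coeff k) h2

/-- The invariants of the pointwise stabiliser of a hyperplane `W` form `S(W)[z]`, where `z` is
the orbit polynomial evaluated at a vector outside `W`. -/
theorem invariantAlg_eq_adjoin (hdimW : Module.finrank F W + 1 = m)
    (hGW : ∀ g ∈ G, ∀ x, x ᵥ* (↑g : Matrix (Fin m) (Fin m) F) - x ∈ W) (hv : v ∉ W) :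
    invariantAlg {M : Matrix (Fin m) (Fin m) F | ∃ g ∈ G,
        (∀ x ∈ W, x ᵥ* (↑g : Matrix (Fin m) (Fin m) F) = x) ∧
        (↑g : Matrix (Fin m) (Fin m) F) = M} =
      Algebra.adjoin F ((linForm '' (W : Set (Fin m → F))) ∪
        {Polynomial.aeval (linForm v) (orbitPoly (displacementsToSym G W v))}) := by
  apply le_antisymm
  · intro f hf
    obtain ⟨P, rfl⟩ := (aeval_linForm_bijective hdimW hv).2 f
    obtain ⟨Q, rfl⟩ := exists_comp_orbitPoly (displacementsToSym G W v)
      (displacementsToSym_injective G W v) P fun w => by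
        obtain ⟨hwW, g, hg, hgW, hgv⟩ := w.2
        apply (aeval_linForm_bijective hdimW hv).1
        rw [← aeval_add_linForm, ← hgv, ← polyAct_linForm, ← polyAct_aeval hgW]
        exact hf _ ⟨g, hg, hgW, rfl⟩
    rw [Polynomial.aeval_comp, Polynomial.aeval_eq_sum_range (p := Q)]
    refine Subalgebra.sum_mem _ fun i _ => ?_
    rw [Subalgebra.smul_def, smul_eq_mul]
    refine mul_mem ?_ (pow_mem ?_ i)
    · exact Algebra.adjoin_mono (s := linForm '' (W : Set (Fin m → F)))
        Set.subset_union_left (Q.coeff i).2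
    · exact Algebra.subset_adjoin (Set.mem_union_right _ (Set.mem_singleton _))
  · refine Algebra.adjoin_le ?_
    rintro _ (⟨w, hw, rfl⟩ | rfl) _ ⟨g, hg, hgW, rfl⟩
    · rw [polyAct_linForm, hgW w hw]
    · have hw : v ᵥ* (↑g : Matrix (Fin m) (Fin m) F) - v ∈ displacements G W v :=
        ⟨hGW g hg v, g, hg, hgW, by abel⟩
      have h := aeval_add_linForm ⟨_, hw⟩ (orbitPoly (displacementsToSym G W v))
      rw [orbitPoly_comp, add_sub_cancel] at h
      rw [polyAct_aeval hgW, polyAct_linForm, h]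

end Invariants

/-- For `G ⊆ GL(V)` finite and generated by transvections and `W ⊆ V` a
`G`-submodule of codimension 1, the pointwise stabiliser `Fix_G(W)` has order `p^t` and, for
any `v ∉ W`, `S(V)^{Fix_G(W)} = S(W)[z]` where
`z = v^{p^t} + q₁ v^{p^{t-1}} + ⋯ + q_t v` with `q_i ∈ S(W)^{G|W}` homogeneous of degree
`p^t - p^{t-i}`. -/
theorem stmt15 (p : ℕ) [Fact p.Prime] (F : Type u) [Field F] [CharP F p] (m : ℕ)
    (G : Subgroup (Matrix (Fin m) (Fin m) F)ˣ) [Finite G]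
    (hgen : Subgroup.closure {g : (Matrix (Fin m) (Fin m) F)ˣ |
      g ∈ G ∧ IsTransvectionMat (↑g : Matrix (Fin m) (Fin m) F)} = G)
    (W : Submodule F (Fin m → F)) (hdimW : Module.finrank F W + 1 = m)
    (hWG : ∀ g ∈ G, ∀ x ∈ W, x ᵥ* (↑g : Matrix (Fin m) (Fin m) F) ∈ W) :
    ∃ t : ℕ,
      Nat.card {g : (Matrix (Fin m) (Fin m) F)ˣ |
        g ∈ G ∧ ∀ x ∈ W, x ᵥ* (↑g : Matrix (Fin m) (Fin m) F) = x} = p ^ t ∧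
      ∀ v : Fin m → F, v ∉ W →
        ∃ q : Fin t → MvPolynomial (Fin m) F,
          (∀ i, q i ∈ Algebra.adjoin F (linForm '' (W : Set (Fin m → F)))) ∧
          (∀ i, (q i).IsHomogeneous (p ^ t - p ^ (t - 1 - (i : ℕ)))) ∧
          (∀ i, ∀ g ∈ G, polyAct (↑g : Matrix (Fin m) (Fin m) F) (q i) = q i) ∧
          invariantAlg {M : Matrix (Fin m) (Fin m) F | ∃ g ∈ G,
              (∀ x ∈ W, x ᵥ* (↑g : Matrix (Fin m) (Fin m) F) = x) ∧
              (↑g : Matrix (Fin m) (Fin m) F) = M} =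
            Algebra.adjoin F ((linForm '' (W : Set (Fin m → F))) ∪
              {linForm v ^ (p ^ t) +
                ∑ i : Fin t, q i * linForm v ^ (p ^ (t - 1 - (i : ℕ)))}) := by
  have hGW : ∀ g ∈ G, ∀ x, x ᵥ* (↑g : Matrix (Fin m) (Fin m) F) - x ∈ W :=
    fun g hg x => vecMul_sub_mem hgen hdimW hWG hg x
  have hfin : Finite {g : (Matrix (Fin m) (Fin m) F)ˣ |
      g ∈ G ∧ ∀ x ∈ W, x ᵥ* (↑g : Matrix (Fin m) (Fin m) F) = x} :=
    Set.Finite.subset (s := (G : Set (Matrix (Fin m) (Fin m) F)ˣ)) (Set.toFinite _)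
      fun g hg => hg.1
  obtain ⟨v₀, hv₀⟩ : ∃ v, v ∉ W := by
    by_contra! h
    rw [(Submodule.eq_top_iff' (p := W)).2 h, finrank_top, Module.finrank_fin_fun] at hdimW
    omega
  obtain ⟨e₀⟩ := exists_equiv_displacements hdimW hGW hv₀
  have := Finite.of_equiv _ e₀
  obtain ⟨t, ht⟩ := exists_card_eq_pow p (displacements G W v₀)
  rw [← Nat.card_congr e₀] at ht
  refine ⟨t, ht, fun v hv => ?_⟩
  obtain ⟨e⟩ := exists_equiv_displacements hdimW hGW hv
  have := Finite.of_equiv _ e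
  have := Fintype.ofFinite (displacements G W v)
  have hcard : Fintype.card (displacements G W v) = p ^ t := by
    rw [← ht, Nat.card_congr e, Nat.card_eq_fintype_card]
  have : CharP (symSubalgebra W) p :=
    charP_of_injective_algebraMap (algebraMap F (symSubalgebra W)).injective p
  refine ⟨fun i => (orbitPoly (displacementsToSym G W v)).coeff (p ^ (t - 1 - (i : ℕ))),
    fun i => Subtype.prop _, fun i => ?_, fun i g hg => polyAct_orbitPoly_coeff hGW hWG hg _, ?_⟩
  · rw [← hcard]
    refine orbitPoly_coeff_isHomogeneous ?_
    rw [hcard]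
    exact Nat.pow_le_pow_right (Fact.out : p.Prime).pos (by omega)
  · rw [invariantAlg_eq_adjoin hdimW hGW hv]
    congr 3
    conv_lhs => rw [orbitPoly_eq_sum p t _ (displacementsToSym_injective G W v) hcard]
    simp only [map_add, map_sum, map_mul, map_pow, Polynomial.aeval_X, Polynomial.aeval_C]
    rfl

end
end
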